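/- arXiv:1806.03344 — 9 statements merged into one kernel-verified Lean document; each statement's English description precedes it below -/
import Mathlib

section
/- For every j ≥ 0 and every integer t with 0 < t ≤ a_{2j+2}, one has f(h_{2j} + t·h_{2j+1}) = k_{2j} + t·k_{2j+1} and g(h_{2j} + t·h_{2j+1}) = k_{2j} + t·k_{2j+1} − 1. -/
theorem tail_irrational_mem_Ioo {α : ℝ} (hirr : Irrational α) (hα0 : 0 < α) (hα1 : α < 1)
    {a : ℕ → ℕ} {β : ℕ → ℝ} (hβ0 : β 0 = α)
    (hfloor : ∀ i, (a (i + 1) : ℤ) = ⌊1 / β i⌋)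
    (hβrec : ∀ i, β (i + 1) = 1 / β i - (a (i + 1) : ℝ)) (i : ℕ) :
    Irrational (β i) ∧ 0 < β i ∧ β i < 1 := by
  induction i with
  | zero => rw [hβ0]; exact ⟨hirr, hα0, hα1⟩
  | succ i ih =>
    have hi : Irrational (β (i + 1)) := by
      rw [hβrec, one_div]
      exact ih.1.inv.sub_natCast _
    have hfract : β (i + 1) = Int.fract (1 / β i) := by
      rw [hβrec, Int.fract, ← hfloor, Int.cast_natCast]
    refine ⟨hi, lt_of_le_of_ne ?_ hi.ne_zero.symm, ?_⟩
    · rw [hfract]; exact Int.fract_nonneg _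
    · rw [hfract]; exact Int.fract_lt_one _

/-- Successive errors `h i - α * k i` of the convergents have ratio `-β (i + 1)`. -/
theorem convergent_error_succ {α : ℝ} {a h k : ℕ → ℕ} {β : ℕ → ℝ}
    (hβ0 : β 0 = α) (hβpos : ∀ i, 0 < β i)
    (hβrec : ∀ i, β (i + 1) = 1 / β i - (a (i + 1) : ℝ))
    (hh0 : h 0 = 0) (hk0 : k 0 = 1) (hh1 : h 1 = 1) (hk1 : k 1 = a 1)
    (hhrec : ∀ i, h (i + 2) = a (i + 2) * h (i + 1) + h i)
    (hkrec : ∀ i, k (i + 2) = a (i + 2) * k (i + 1) + k i) (i : ℕ) :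
    (h (i + 1) - α * k (i + 1) : ℝ) = -β (i + 1) * (h i - α * k i) := by
  have hmul (i : ℕ) : β i * β (i + 1) = 1 - β i * a (i + 1) := by
    rw [hβrec, mul_sub, mul_one_div_cancel (hβpos i).ne']
  induction i with
  | zero =>
    have := hmul 0
    rw [hβ0] at this
    simp only [zero_add] at this ⊢
    rw [hh0, hk0, hh1, hk1]
    push_cast
    linarith
  | succ i ih =>
    have h2 := hmul (i + 1)
    rw [hhrec, hkrec]
    push_cast
    refine mul_left_cancel₀ (hβpos (i + 1)).ne' ?_
    linear_combination (h (i + 1) - α * k (i + 1) : ℝ) * h2 + ih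

/- Context: α ∈ (0,1) irrational with simple continued fraction expansion
α = [0; a₁, a₂, …] computed by the usual algorithm (β i are the tails),
and hᵢ/kᵢ the convergents given by the standard recurrences. -/
theorem stmt_1 (α : ℝ) (hirr : Irrational α) (hα0 : 0 < α) (hα1 : α < 1)
    (a h k : ℕ → ℕ) (β : ℕ → ℝ)
    (ha0 : a 0 = 0) (hapos : ∀ i, 1 ≤ i → 1 ≤ a i)
    (hβ0 : β 0 = α)
    (hfloor : ∀ i, (a (i + 1) : ℤ) = ⌊1 / β i⌋)
    (hβrec : ∀ i, β (i + 1) = 1 / β i - (a (i + 1) : ℝ))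
    (hh0 : h 0 = 0) (hk0 : k 0 = 1) (hh1 : h 1 = 1) (hk1 : k 1 = a 1)
    (hhrec : ∀ i, h (i + 2) = a (i + 2) * h (i + 1) + h i)
    (hkrec : ∀ i, k (i + 2) = a (i + 2) * k (i + 1) + k i) :
    ∀ j t : ℕ, 0 < t → t ≤ a (2 * j + 2) →
      ⌈((h (2 * j) + t * h (2 * j + 1) : ℕ) : ℝ) / α⌉
          = ((k (2 * j) + t * k (2 * j + 1) : ℕ) : ℤ) ∧
      ⌊((h (2 * j) + t * h (2 * j + 1) : ℕ) : ℝ) / α⌋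
          = ((k (2 * j) + t * k (2 * j + 1) : ℕ) : ℤ) - 1 := by
  intro j t ht hta
  have hβ := tail_irrational_mem_Ioo hirr hα0 hα1 hβ0 hfloor hβrec
  have herr := convergent_error_succ hβ0 (fun i => (hβ i).2.1) hβrec hh0 hk0 hh1 hk1 hhrec hkrec
  have heven : ∀ j : ℕ, -α ≤ (h (2 * j) - α * k (2 * j) : ℝ) ∧
      (h (2 * j) - α * k (2 * j) : ℝ) < 0 := by
    intro j
    induction j with
    | zero => simp [hh0, hk0, hα0]
    | succ j ih =>
      have e : (h (2 * (j + 1)) - α * k (2 * (j + 1)) : ℝ) =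
          (β (2 * j + 2) * β (2 * j + 1)) * (h (2 * j) - α * k (2 * j)) := by
        rw [show 2 * (j + 1) = 2 * j + 1 + 1 by ring, herr, herr]
        ring
      obtain ⟨-, hp1, hl1⟩ := hβ (2 * j + 1)
      obtain ⟨-, hp2, hl2⟩ := hβ (2 * j + 2)
      have hp := mul_pos hp2 hp1
      have hl : β (2 * j + 2) * β (2 * j + 1) ≤ 1 := mul_le_one₀ hl2.le hp1.le hl1.le
      rw [e]
      constructor <;> nlinarith
  obtain ⟨hlo, hneg⟩ := heven j
  have hp1 := (hβ (2 * j + 1)).2.1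
  have htβ : (t : ℝ) * β (2 * j + 1) < 1 := by
    have hp2 := (hβ (2 * j + 2)).2.1
    rw [hβrec (2 * j + 1)] at hp2
    have hta' : (t : ℝ) ≤ a (2 * j + 2) := by exact_mod_cast hta
    rw [← lt_div_iff₀ hp1]
    linarith
  have htpos : 0 < (t : ℝ) * β (2 * j + 1) := mul_pos (by exact_mod_cast ht) hp1
  have e : ((h (2 * j) + t * h (2 * j + 1) : ℕ) : ℝ) -
      α * ((k (2 * j) + t * k (2 * j + 1) : ℕ) : ℝ) =
      (h (2 * j) - α * k (2 * j)) * (1 - t * β (2 * j + 1)) := by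
    push_cast
    linear_combination (t : ℝ) * herr (2 * j)
  generalize h (2 * j) + t * h (2 * j + 1) = H at e ⊢
  generalize k (2 * j) + t * k (2 * j + 1) = K at e ⊢
  have hlt : (H : ℝ) / α < K := by
    rw [div_lt_iff₀ hα0]
    nlinarith
  have hgt : (K : ℝ) - 1 < H / α := by
    rw [lt_div_iff₀ hα0]
    nlinarith
  refine ⟨Int.ceil_eq_iff.2 ⟨?_, ?_⟩, Int.floor_eq_iff.2 ⟨?_, ?_⟩⟩ <;> push_cast <;> linarith
end

section
/- For every l ≥ 1 and every integer t with 0 ≤ t ≤ a_{2l+1}, one has g(h_{2l−1} + t·h_{2l}) = k_{2l−1} + t·k_{2l} and f(h_{2l−1} + t·h_{2l}) = k_{2l−1} + t·k_{2l} + 1. -/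
/-- The tails of the continued fraction of an irrational number in `(0, 1)` are irrational
and lie in `(0, 1)`. -/
theorem irrational_and_mem_Ioo_tail (a : ℕ → ℕ) (β : ℕ → ℝ)
    (hirr : Irrational (β 0)) (hβ0 : 0 < β 0) (hβ1 : β 0 < 1)
    (hfloor : ∀ i, (a (i + 1) : ℤ) = ⌊1 / β i⌋)
    (hβrec : ∀ i, β (i + 1) = 1 / β i - (a (i + 1) : ℝ)) (i : ℕ) :
    Irrational (β i) ∧ 0 < β i ∧ β i < 1 := by
  induction i with
  | zero => exact ⟨hirr, hβ0, hβ1⟩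
  | succ i ih =>
    have hi : Irrational (β (i + 1)) := by
      rw [hβrec, one_div]
      exact ih.1.inv.sub_natCast _
    have hcast : (a (i + 1) : ℝ) = (⌊1 / β i⌋ : ℝ) := by
      rw [← hfloor i]
      norm_cast
    have hfract : β (i + 1) = Int.fract (1 / β i) := by
      rw [hβrec, hcast, Int.fract]
    refine ⟨hi, lt_of_le_of_ne ?_ hi.ne_zero.symm, ?_⟩
    · rw [hfract]
      exact Int.fract_nonneg _
    · rw [hfract]
      exact Int.fract_lt_one _

open Finset in
/-- The approximation error `h i - α * k i` is, up to an alternating sign, the product of the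
first tails. -/
theorem convergent_error_eq_prod_tails (a h k : ℕ → ℕ) (β : ℕ → ℝ)
    (hne : ∀ i, β i ≠ 0)
    (hβrec : ∀ i, β (i + 1) = 1 / β i - (a (i + 1) : ℝ))
    (hh0 : h 0 = 0) (hk0 : k 0 = 1) (hh1 : h 1 = 1) (hk1 : k 1 = a 1)
    (hhrec : ∀ i, h (i + 2) = a (i + 2) * h (i + 1) + h i)
    (hkrec : ∀ i, k (i + 2) = a (i + 2) * k (i + 1) + k i) (i : ℕ) :
    (h i : ℝ) - β 0 * k i = (-1) ^ (i + 1) * ∏ j ∈ range (i + 1), β j := by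
  have hmul (i : ℕ) : β i * β (i + 1) = 1 - a (i + 1) * β i := by
    rw [hβrec, mul_sub, mul_one_div_cancel (hne i), mul_comm (β i)]
  induction i using Nat.twoStepInduction with
  | zero => simp [hh0, hk0]
  | one =>
    simp only [hh1, hk1, prod_range_succ, prod_range_zero]
    linear_combination -hmul 0
  | more i ih₀ ih₁ =>
    rw [prod_range_succ] at ih₁
    rw [hhrec, hkrec, prod_range_succ, prod_range_succ]
    push_cast
    linear_combination (a (i + 2) : ℝ) * ih₁ + ih₀ +
      (-1) ^ i * (∏ j ∈ range (i + 1), β j) * hmul (i + 1)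


/- Context: α ∈ (0,1) irrational with simple continued fraction expansion
α = [0; a₁, a₂, …] computed by the usual algorithm (β i are the tails),
and hᵢ/kᵢ the convergents given by the standard recurrences. -/
theorem stmt_2 (α : ℝ) (hirr : Irrational α) (hα0 : 0 < α) (hα1 : α < 1)
    (a h k : ℕ → ℕ) (β : ℕ → ℝ)
    (ha0 : a 0 = 0) (hapos : ∀ i, 1 ≤ i → 1 ≤ a i)
    (hβ0 : β 0 = α)
    (hfloor : ∀ i, (a (i + 1) : ℤ) = ⌊1 / β i⌋)
    (hβrec : ∀ i, β (i + 1) = 1 / β i - (a (i + 1) : ℝ))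
    (hh0 : h 0 = 0) (hk0 : k 0 = 1) (hh1 : h 1 = 1) (hk1 : k 1 = a 1)
    (hhrec : ∀ i, h (i + 2) = a (i + 2) * h (i + 1) + h i)
    (hkrec : ∀ i, k (i + 2) = a (i + 2) * k (i + 1) + k i) :
    ∀ l t : ℕ, 1 ≤ l → t ≤ a (2 * l + 1) →
      ⌊((h (2 * l - 1) + t * h (2 * l) : ℕ) : ℝ) / α⌋
          = ((k (2 * l - 1) + t * k (2 * l) : ℕ) : ℤ) ∧
      ⌈((h (2 * l - 1) + t * h (2 * l) : ℕ) : ℝ) / α⌉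
          = ((k (2 * l - 1) + t * k (2 * l) : ℕ) : ℤ) + 1 := by
  intro l t hl ht
  subst hβ0
  have hβ := irrational_and_mem_Ioo_tail a β hirr hα0 hα1 hfloor hβrec
  have herr := convergent_error_eq_prod_tails a h k β (fun i ↦ (hβ i).2.1.ne') hβrec
    hh0 hk0 hh1 hk1 hhrec hkrec
  obtain ⟨m, rfl⟩ := Nat.exists_eq_add_of_le' hl
  rw [show 2 * (m + 1) - 1 = 2 * m + 1 by lia, show 2 * (m + 1) = 2 * m + 2 by ring] at *
  have hodd := herr (2 * m + 1)
  have heven := herr (2 * m + 2)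
  rw [Finset.prod_range_succ] at heven
  rw [Even.neg_one_pow ⟨m + 1, by ring⟩, one_mul] at hodd
  rw [Odd.neg_one_pow ⟨m + 1, by ring⟩] at heven
  have hPpos : 0 < ∏ j ∈ Finset.range (2 * m + 1 + 1), β j :=
    Finset.prod_pos fun i _ ↦ (hβ i).2.1
  have hPlt : ∏ j ∈ Finset.range (2 * m + 1 + 1), β j < β 0 := by
    rw [Finset.prod_range_succ', Finset.prod_range_succ]
    have hle : ∏ j ∈ Finset.range (2 * m), β (j + 1) ≤ 1 :=
      Finset.prod_le_one (fun i _ ↦ (hβ _).2.1.le) fun i _ ↦ (hβ _).2.2.le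
    have hlt : (∏ j ∈ Finset.range (2 * m), β (j + 1)) * β (2 * m + 1) < 1 :=
      mul_lt_one_of_nonneg_of_lt_one_right hle (hβ _).2.1.le (hβ _).2.2
    exact mul_lt_of_lt_one_left hα0 hlt
  set P := ∏ j ∈ Finset.range (2 * m + 1 + 1), β j
  have hb := (hβ (2 * m + 2)).2.1
  have htb0 : 0 ≤ t * β (2 * m + 2) := by positivity
  have htb1 : t * β (2 * m + 2) < 1 := by
    have hlt : (a (2 * m + 2 + 1) : ℝ) < 1 / β (2 * m + 2) := by
      linarith [hβrec (2 * m + 2), (hβ (2 * m + 2 + 1)).2.1]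
    have htr : (t : ℝ) ≤ a (2 * m + 2 + 1) := by exact_mod_cast ht
    exact (lt_div_iff₀ hb).1 (htr.trans_lt hlt)
  have hdiff : ((h (2 * m + 1) + t * h (2 * m + 2) : ℕ) : ℝ)
      - β 0 * ((k (2 * m + 1) + t * k (2 * m + 2) : ℕ) : ℝ) = P * (1 - t * β (2 * m + 2)) := by
    push_cast
    linear_combination hodd + t * heven
  have hdpos : 0 < P * (1 - t * β (2 * m + 2)) := mul_pos hPpos (sub_pos.2 htb1)
  have hdlt : P * (1 - t * β (2 * m + 2)) < β 0 := by nlinarith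
  have hlo : ((k (2 * m + 1) + t * k (2 * m + 2) : ℕ) : ℝ)
      < ((h (2 * m + 1) + t * h (2 * m + 2) : ℕ) : ℝ) / β 0 := by
    rw [lt_div_iff₀ hα0]
    linarith
  have hhi : ((h (2 * m + 1) + t * h (2 * m + 2) : ℕ) : ℝ) / β 0
      < ((k (2 * m + 1) + t * k (2 * m + 2) : ℕ) : ℝ) + 1 := by
    rw [div_lt_iff₀ hα0]
    linarith
  constructor
  · rw [Int.floor_eq_iff, Int.cast_natCast]
    exact ⟨hlo.le, hhi⟩
  · rw [Int.ceil_eq_iff, Int.cast_add, Int.cast_natCast, Int.cast_one, add_sub_cancel_right]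
    exact ⟨hlo, hhi.le⟩
end

section
/- For every j ≥ 0 and every integer t with 0 < t ≤ a_{2j+2}, one has (k_{2j} + t·k_{2j+1} − 1)·α < h_{2j} + t·h_{2j+1} < (k_{2j} + t·k_{2j+1})·α. -/
/-- The Gauss map preserves the irrational numbers of the open unit interval. -/
theorem Irrational.inv_sub_floor {x : ℝ} (hx : Irrational x) :
    Irrational (1 / x - (⌊1 / x⌋ : ℝ)) ∧ 0 < 1 / x - (⌊1 / x⌋ : ℝ) ∧
      1 / x - (⌊1 / x⌋ : ℝ) < 1 := by
  have h : Irrational (1 / x - (⌊1 / x⌋ : ℝ)) := by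
    rw [one_div]
    exact hx.inv.sub_intCast _
  refine ⟨h, lt_of_le_of_ne ?_ h.ne_zero.symm, ?_⟩
  · linarith [Int.floor_le (1 / x)]
  · linarith [Int.lt_floor_add_one (1 / x)]


/- Context: α ∈ (0,1) irrational with simple continued fraction expansion
α = [0; a₁, a₂, …] computed by the usual algorithm (β i are the tails),
and hᵢ/kᵢ the convergents given by the standard recurrences. -/
theorem stmt_3 (α : ℝ) (hirr : Irrational α) (hα0 : 0 < α) (hα1 : α < 1)
    (a h k : ℕ → ℕ) (β : ℕ → ℝ)
    (ha0 : a 0 = 0) (hapos : ∀ i, 1 ≤ i → 1 ≤ a i)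
    (hβ0 : β 0 = α)
    (hfloor : ∀ i, (a (i + 1) : ℤ) = ⌊1 / β i⌋)
    (hβrec : ∀ i, β (i + 1) = 1 / β i - (a (i + 1) : ℝ))
    (hh0 : h 0 = 0) (hk0 : k 0 = 1) (hh1 : h 1 = 1) (hk1 : k 1 = a 1)
    (hhrec : ∀ i, h (i + 2) = a (i + 2) * h (i + 1) + h i)
    (hkrec : ∀ i, k (i + 2) = a (i + 2) * k (i + 1) + k i) :
    ∀ j t : ℕ, 0 < t → t ≤ a (2 * j + 2) →
      (((k (2 * j) + t * k (2 * j + 1) : ℕ) : ℝ) - 1) * α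
          < ((h (2 * j) + t * h (2 * j + 1) : ℕ) : ℝ) ∧
      ((h (2 * j) + t * h (2 * j + 1) : ℕ) : ℝ)
          < ((k (2 * j) + t * k (2 * j + 1) : ℕ) : ℝ) * α := by
  have hcast : ∀ i, (a (i + 1) : ℝ) = (⌊1 / β i⌋ : ℝ) := fun i => by
    exact_mod_cast hfloor i
  have hβ : ∀ i, Irrational (β i) ∧ 0 < β i ∧ β i < 1 := by
    intro i
    induction i with
    | zero => rw [hβ0]; exact ⟨hirr, hα0, hα1⟩
    | succ i ih =>
      rw [hβrec, hcast]
      exact ih.1.inv_sub_floor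
  have hmul : ∀ i, β (i + 1) * β i = 1 - a (i + 1) * β i := fun i => by
    rw [hβrec, sub_mul, one_div, inv_mul_cancel₀ (hβ i).2.1.ne']
  have herr : ∀ i, (k (i + 1) * α - h (i + 1) : ℝ) = -β (i + 1) * (k i * α - h i) := by
    intro i
    induction i with
    | zero =>
      have := hmul 0
      rw [hβ0] at this
      simp only [zero_add, hk1, hh1, hk0, hh0] at this ⊢
      push_cast
      linarith
    | succ i ih =>
      rw [hkrec, hhrec]
      push_cast
      apply mul_left_cancel₀ (hβ (i + 1)).2.1.ne'
      linear_combination ih + (k (i + 1) * α - h (i + 1) : ℝ) * hmul (i + 1)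
  have heven : ∀ j, 0 < (k (2 * j) * α - h (2 * j) : ℝ) ∧
      (k (2 * j) * α - h (2 * j) : ℝ) ≤ α := by
    intro j
    induction j with
    | zero => simp [hk0, hh0, hα0]
    | succ j ih =>
      have e : (k (2 * (j + 1)) * α - h (2 * (j + 1)) : ℝ) =
          β (2 * j + 2) * β (2 * j + 1) * (k (2 * j) * α - h (2 * j)) := by
        rw [show 2 * (j + 1) = 2 * j + 1 + 1 by ring, herr, herr]
        ring
      obtain ⟨-, hp, hp'⟩ := hβ (2 * j + 1)
      obtain ⟨-, hq, hq'⟩ := hβ (2 * j + 2)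
      rw [e]
      refine ⟨mul_pos (mul_pos hq hp) ih.1, le_trans ?_ ih.2⟩
      exact mul_le_of_le_one_left ih.1.le (mul_le_one₀ hq'.le hp.le hp'.le)
  intro j t ht hta
  have ht0 : (0 : ℝ) < t := by exact_mod_cast ht
  have hta' : (t : ℝ) ≤ a (2 * j + 2) := by exact_mod_cast hta
  obtain ⟨hpos, hle⟩ := heven j
  have hb := (hβ (2 * j + 1)).2.1
  have htb : (t : ℝ) * β (2 * j + 1) < 1 := by
    have h1 := hmul (2 * j + 1)
    have h2 := mul_pos (hβ (2 * j + 1 + 1)).2.1 hb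
    have h3 := mul_le_mul_of_nonneg_right hta' hb.le
    linarith
  have hsum : ((k (2 * j) + t * k (2 * j + 1)) * α - (h (2 * j) + t * h (2 * j + 1)) : ℝ) =
      (1 - t * β (2 * j + 1)) * (k (2 * j) * α - h (2 * j)) := by
    linear_combination (t : ℝ) * herr (2 * j)
  have hlow := mul_pos (sub_pos.mpr htb) hpos
  have hupp := mul_pos (mul_pos ht0 hb) hpos
  push_cast
  constructor <;> linarith
end

section
/- Let n ≥ 1 be an integer such that the fraction n/f(n) is not equal to (h_{2j} + t·h_{2j+1})/(k_{2j} + t·k_{2j+1}) for any j ≥ 0 and any integer t with 0 ≤ t < a_{2j+2}. Then there exist j ≥ 0 and an integer t with 0 ≤ t < a_{2j+2} such that n > h_{2j} + t·h_{2j+1}, f(n) > k_{2j} + t·k_{2j+1} = f(h_{2j} + t·h_{2j+1}) (where for j = t = 0 this reads f(n) > k₀ = 1), and f(n)·α − n > (k_{2j} + t·k_{2j+1})·α − (h_{2j} + t·h_{2j+1}). -/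
/-- In a unimodular basis `(p, q)`, `(r, s)` of `ℤ²` whose linear forms satisfy `u = q α - p > 0`,
`w = s α - r < 0`, `u + w > 0`, a point `(n, f)` with `0 < f α - n ≤ u` and `p < n ≤ p + r` is the
sum of the two basis vectors, unless it is the first one. -/
theorem eq_add_of_form_le {α : ℝ} {p q r s n f : ℤ} (hp : 0 ≤ p) (hr : 1 ≤ r)
    (hdet : r * q - p * s = 1) (hw : (s : ℝ) * α - r < 0)
    (huw : 0 < ((q : ℝ) * α - p) + ((s : ℝ) * α - r))
    (hpos : 0 < (f : ℝ) * α - n) (hle : (f : ℝ) * α - n ≤ (q : ℝ) * α - p)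
    (hpn : p < n) (hnr : n ≤ p + r) : n = p + r ∧ f = q + s := by
  obtain ⟨x, hx⟩ : ∃ x, x = r * f - s * n := ⟨_, rfl⟩
  obtain ⟨y, hy⟩ : ∃ y, y = q * n - p * f := ⟨_, rfl⟩
  have hn : n = x * p + y * r := by rw [hx, hy]; linear_combination (-n) * hdet
  have hf : f = x * q + y * s := by rw [hx, hy]; linear_combination (-f) * hdet
  have hform : (f : ℝ) * α - n = x * ((q : ℝ) * α - p) + y * ((s : ℝ) * α - r) := by
    rw [hn, hf]; push_cast; ring
  rw [hform] at hpos hle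
  generalize (q : ℝ) * α - p = u at *
  generalize (s : ℝ) * α - r = w at *
  have hx1 : 1 ≤ x := by
    by_contra! hx0
    have hy1 : 1 ≤ y := by
      by_contra! hy0
      nlinarith
    have h1 : (x : ℝ) ≤ 0 := by exact_mod_cast (by omega : x ≤ 0)
    have h2 : (1 : ℝ) ≤ y := by exact_mod_cast hy1
    nlinarith
  have hx1' : (1 : ℝ) ≤ x := by exact_mod_cast hx1
  have hy0 : 0 ≤ y := by
    by_contra! hy0
    have h2 : (y : ℝ) < 0 := by exact_mod_cast hy0
    nlinarith
  have hy1 : 1 ≤ y := by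
    by_contra! hy1
    have hy : y = 0 := by omega
    have hx2 : 2 ≤ x := by
      by_contra! hx2
      have hx : x = 1 := by omega
      rw [hx, hy] at hn
      omega
    have h2 : (2 : ℝ) ≤ x := by exact_mod_cast hx2
    rw [hy] at hle
    push_cast at hle
    nlinarith
  have hy' : y = 1 := by nlinarith
  have hx' : x = 1 := by
    by_contra hx'
    have h2 : (2 : ℝ) ≤ x := by exact_mod_cast (by omega : 2 ≤ x)
    rw [hy'] at hle
    push_cast at hle
    nlinarith
  rw [hx', hy'] at hn hf
  exact ⟨by omega, by omega⟩

/-- The tails of the continued fraction algorithm of an irrational number stay irrational and in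
`(0, 1)`. -/
theorem tail_irrational_pos {a : ℕ → ℕ} {β : ℕ → ℝ} (h0 : Irrational (β 0)) (hpos : 0 < β 0)
    (hfloor : ∀ i, (a (i + 1) : ℤ) = ⌊1 / β i⌋)
    (hrec : ∀ i, β (i + 1) = 1 / β i - (a (i + 1) : ℝ)) (i : ℕ) :
    Irrational (β i) ∧ 0 < β i := by
  induction i with
  | zero => exact ⟨h0, hpos⟩
  | succ i ih =>
    have hirr : Irrational (β (i + 1)) := by
      rw [hrec, one_div]
      exact ih.1.inv.sub_natCast _
    refine ⟨hirr, lt_of_le_of_ne ?_ hirr.ne_zero.symm⟩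
    have h : ((a (i + 1) : ℤ) : ℝ) ≤ 1 / β i := by
      rw [hfloor]
      exact Int.floor_le _
    rw [hrec]
    push_cast at h
    linarith


/- Context: α ∈ (0,1) irrational with simple continued fraction expansion
α = [0; a₁, a₂, …] computed by the usual algorithm (β i are the tails),
and hᵢ/kᵢ the convergents given by the standard recurrences. -/
theorem stmt_8 (α : ℝ) (hirr : Irrational α) (hα0 : 0 < α) (hα1 : α < 1)
    (a h k : ℕ → ℕ) (β : ℕ → ℝ)
    (ha0 : a 0 = 0) (hapos : ∀ i, 1 ≤ i → 1 ≤ a i)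
    (hβ0 : β 0 = α)
    (hfloor : ∀ i, (a (i + 1) : ℤ) = ⌊1 / β i⌋)
    (hβrec : ∀ i, β (i + 1) = 1 / β i - (a (i + 1) : ℝ))
    (hh0 : h 0 = 0) (hk0 : k 0 = 1) (hh1 : h 1 = 1) (hk1 : k 1 = a 1)
    (hhrec : ∀ i, h (i + 2) = a (i + 2) * h (i + 1) + h i)
    (hkrec : ∀ i, k (i + 2) = a (i + 2) * k (i + 1) + k i)
    (n : ℕ) (hn : 1 ≤ n)
    (hne : ∀ j t : ℕ, t < a (2 * j + 2) →
      (n : ℚ) / ((⌈(n : ℝ) / α⌉ : ℤ) : ℚ)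
        ≠ ((h (2 * j) + t * h (2 * j + 1) : ℕ) : ℚ)
            / ((k (2 * j) + t * k (2 * j + 1) : ℕ) : ℚ)) :
    ∃ j t : ℕ, t < a (2 * j + 2) ∧
      h (2 * j) + t * h (2 * j + 1) < n ∧
      ((k (2 * j) + t * k (2 * j + 1) : ℕ) : ℤ) < ⌈(n : ℝ) / α⌉ ∧
      (¬(j = 0 ∧ t = 0) →
        ((k (2 * j) + t * k (2 * j + 1) : ℕ) : ℤ)
          = ⌈((h (2 * j) + t * h (2 * j + 1) : ℕ) : ℝ) / α⌉) ∧
      (⌈(n : ℝ) / α⌉ : ℝ) * α - (n : ℝ)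
        > ((k (2 * j) + t * k (2 * j + 1) : ℕ) : ℝ) * α
            - ((h (2 * j) + t * h (2 * j + 1) : ℕ) : ℝ) := by
  have hβ : ∀ i, 0 < β i := fun i =>
    (tail_irrational_pos (hβ0 ▸ hirr) (hβ0 ▸ hα0) hfloor hβrec i).2
  set D : ℕ → ℝ := fun i => (k i : ℝ) * α - h i with hD
  have hDstep : ∀ i, D (i + 1) = -β (i + 1) * D i := by
    intro i
    induction i with
    | zero =>
      simp only [hD, hβrec 0, hβ0, hh0, hh1, hk0, hk1]
      field_simp
      push_cast
      ring
    | succ i ih =>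
      have hDrec : D (i + 2) = a (i + 2) * D (i + 1) + D i := by
        simp only [hD, hhrec, hkrec]
        push_cast
        ring
      have hne' := (hβ (i + 1)).ne'
      have hi : D i = -(1 / β (i + 1)) * D (i + 1) := by
        rw [ih]
        field_simp
      change D (i + 2) = -β (i + 2) * D (i + 1)
      rw [hDrec, hβrec (i + 1), hi]
      ring
  have hDpos : ∀ j, 0 < D (2 * j) ∧ D (2 * j + 1) < 0 := by
    have hneg : ∀ i, 0 < D i → D (i + 1) < 0 := fun i hi => by
      rw [hDstep]
      nlinarith [mul_pos (hβ (i + 1)) hi]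
    intro j
    induction j with
    | zero =>
      have h0 : 0 < D 0 := by simpa [hD, hh0, hk0] using hα0
      exact ⟨h0, hneg 0 h0⟩
    | succ j ih =>
      have h0 : 0 < D (2 * j + 2) := by
        rw [hDstep]
        nlinarith [mul_pos (hβ (2 * j + 2)) (neg_pos.2 ih.2)]
      exact ⟨h0, hneg _ h0⟩
  have hDrec : ∀ j, D (2 * j + 2) = D (2 * j) + a (2 * j + 2) * D (2 * j + 1) := by
    intro j
    simp only [hD, hhrec, hkrec]
    push_cast
    ring
  have hDlt : ∀ j, D (2 * (j + 1)) < D (2 * j) := by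
    intro j
    have h1 : (1 : ℝ) ≤ a (2 * j + 2) := by exact_mod_cast hapos (2 * j + 2) (by omega)
    have := hDrec j
    change D (2 * j + 2) < _
    nlinarith [(hDpos j).2]
  have hDanti : StrictAnti fun j => D (2 * j) := strictAnti_nat_of_succ_lt hDlt
  have hD0 : D (2 * 0) = α := by simp [hD, hh0, hk0]
  have hdet : ∀ i, (h (i + 1) : ℤ) * k i - h i * k (i + 1) = (-1) ^ i := by
    intro i
    induction i with
    | zero => simp [hh0, hh1, hk0]
    | succ i ih =>
      rw [pow_succ, ← ih, hhrec, hkrec]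
      push_cast
      ring
  have hodd : ∀ j, 1 ≤ h (2 * j + 1) := by
    intro j
    induction j with
    | zero => simp [hh1]
    | succ j ih =>
      have := hhrec (2 * j + 1)
      change 1 ≤ h (2 * j + 1 + 2)
      omega
  have hgrow : ∀ j, j ≤ h (2 * j) := by
    intro j
    induction j with
    | zero => simp
    | succ j ih =>
      have h1 := Nat.mul_le_mul (hapos (2 * j + 2) (by omega)) (hodd j)
      have := hhrec (2 * j)
      change j + 1 ≤ h (2 * j + 2)
      omega
  obtain ⟨j, hj, hj'⟩ : ∃ j, h (2 * j) < n ∧ n ≤ h (2 * j + 2) := by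
    have hex : ∃ j, n ≤ h (2 * j + 2) := ⟨n, (Nat.le_succ n).trans (hgrow (n + 1))⟩
    refine ⟨Nat.find hex, ?_, Nat.find_spec hex⟩
    rcases hm : Nat.find hex with _ | m
    · simp only [mul_zero, hh0]; omega
    · exact not_le.1 (Nat.find_min hex (m := m) (by omega))
  obtain ⟨t, hta, ht, ht'⟩ : ∃ t, t < a (2 * j + 2) ∧ h (2 * j) + t * h (2 * j + 1) < n ∧
      n ≤ h (2 * j) + (t + 1) * h (2 * j + 1) := by
    have ha1 := hapos (2 * j + 2) (by omega)
    have hlast : n ≤ h (2 * j) + (a (2 * j + 2) - 1 + 1) * h (2 * j + 1) := by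
      rw [Nat.sub_add_cancel ha1, add_comm, ← hhrec]
      exact hj'
    have hex : ∃ t, n ≤ h (2 * j) + (t + 1) * h (2 * j + 1) := ⟨_, hlast⟩
    have hfind := Nat.find_min' hex hlast
    refine ⟨Nat.find hex, by omega, ?_, Nat.find_spec hex⟩
    rcases hm : Nat.find hex with _ | m
    · simpa using hj
    · exact not_le.1 (Nat.find_min hex (m := m) (by omega))
  obtain ⟨hE, hO⟩ := hDpos j
  have hform : ∀ t : ℕ, ((k (2 * j) + t * k (2 * j + 1) : ℕ) : ℝ) * α
      - ((h (2 * j) + t * h (2 * j + 1) : ℕ) : ℝ) = D (2 * j) + t * D (2 * j + 1) := by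
    intro t
    simp only [hD]
    push_cast
    ring
  have hformpos : ∀ t : ℕ, t ≤ a (2 * j + 2) → 0 < D (2 * j) + t * D (2 * j + 1) := by
    intro t ht
    have h1 : (t : ℝ) ≤ a (2 * j + 2) := by exact_mod_cast ht
    have h2 : 0 < D (2 * j + 2) := (hDpos (j + 1)).1
    rw [hDrec] at h2
    nlinarith
  have hnpos : (0 : ℝ) < n := by exact_mod_cast hn
  obtain ⟨f, hf⟩ : ∃ f : ℤ, f = ⌈(n : ℝ) / α⌉ := ⟨_, rfl⟩
  have hfpos : 0 < (f : ℝ) * α - n := by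
    have h1 : (n : ℝ) ≤ f * α := by
      rw [← div_le_iff₀ hα0, hf]
      exact Int.le_ceil _
    have hf0 : f ≠ 0 := by
      rintro rfl
      push_cast at h1
      linarith
    exact lt_of_le_of_ne (by linarith) (((hirr.intCast_mul hf0).sub_natCast n).ne_zero).symm
  rw [← hf] at hne ⊢
  have hgt : (f : ℝ) * α - n > ((k (2 * j) + t * k (2 * j + 1) : ℕ) : ℝ) * α
      - ((h (2 * j) + t * h (2 * j + 1) : ℕ) : ℝ) := by
    by_contra! hle
    have hnext := hformpos (t + 1) hta
    obtain ⟨hn', hf'⟩ := eq_add_of_form_le (α := α) (n := n) (f := f)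
      (p := (h (2 * j) + t * h (2 * j + 1) : ℕ)) (q := (k (2 * j) + t * k (2 * j + 1) : ℕ))
      (r := h (2 * j + 1)) (s := k (2 * j + 1)) (by positivity) (by exact_mod_cast hodd j)
      (by
        have := hdet (2 * j)
        rw [pow_mul, neg_one_sq, one_pow] at this
        push_cast
        linear_combination this)
      (by exact_mod_cast hO)
      (by
        rw [Int.cast_natCast, Int.cast_natCast, hform]
        push_cast at hnext ⊢
        simp only [hD] at hnext ⊢
        linarith)
      (by exact_mod_cast hfpos) (by exact_mod_cast hle) (by exact_mod_cast ht)
      (by push_cast; zify at ht'; linarith)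
    have hn1 : n = h (2 * j) + (t + 1) * h (2 * j + 1) := by
      zify; rw [hn']; push_cast; ring
    have hf1 : f = ((k (2 * j) + (t + 1) * k (2 * j + 1) : ℕ) : ℤ) := by
      rw [hf']; push_cast; ring
    rcases (Nat.succ_le_of_lt hta).lt_or_eq with hlt | heq
    · refine hne j (t + 1) hlt ?_
      rw [hf1, hn1, Int.cast_natCast]
    · have heq' : t + 1 = a (2 * j + 2) := heq
      refine hne (j + 1) 0 (hapos _ (by omega)) ?_
      rw [hf1, hn1, Int.cast_natCast, heq', show 2 * (j + 1) = 2 * j + 2 by ring, hhrec, hkrec,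
        zero_mul, zero_mul, add_zero, add_zero, add_comm (h (2 * j)), add_comm (k (2 * j))]
  refine ⟨j, t, hta, ht, ?_, fun hjt => ?_, hgt⟩
  · have ht1 : ((h (2 * j) + t * h (2 * j + 1) : ℕ) : ℝ) < n := by exact_mod_cast ht
    have : (((k (2 * j) + t * k (2 * j + 1) : ℕ) : ℤ) : ℝ) < f := by
      rw [Int.cast_natCast]
      exact lt_of_mul_lt_mul_right (by linarith) hα0.le
    exact_mod_cast this
  · have hlt : D (2 * j) + t * D (2 * j + 1) < α := by
      rcases Nat.eq_zero_or_pos t with rfl | htpos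
      · have := hDanti (show 0 < j by omega)
        simp only [hD0] at this
        simpa using this
      · have h1 : (1 : ℝ) ≤ t := by exact_mod_cast htpos
        have := hDanti.antitone (Nat.zero_le j)
        simp only [hD0] at this
        nlinarith
    have hpos := hformpos t hta.le
    rw [← hform] at hlt hpos
    symm
    rw [Int.ceil_eq_iff, Int.cast_natCast, lt_div_iff₀ hα0, div_le_iff₀ hα0]
    constructor <;> linarith
end

section
/- Let n ≥ 1 be an integer such that the fraction n/g(n) is not equal to (h_{2l−1} + t·h_{2l})/(k_{2l−1} + t·k_{2l}) for any l ≥ 1 and any integer t with 0 ≤ t < a_{2l+1}. Then there exist l ≥ 1 and an integer t with 0 ≤ t < a_{2l+1} such that n > h_{2l−1} + t·h_{2l}, g(n) > k_{2l−1} + t·k_{2l} = g(h_{2l−1} + t·h_{2l}), and n − g(n)·α > (h_{2l−1} + t·h_{2l}) − (k_{2l−1} + t·k_{2l})·α. -/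
/-- The tails of a continued fraction of an irrational number in `(0, 1)` stay irrational
and in `(0, 1)`. -/
theorem tail_irrational_mem_Ioo_s9 {a : ℕ → ℕ} {β : ℕ → ℝ} (hirr : Irrational (β 0))
    (h0 : β 0 ∈ Set.Ioo (0 : ℝ) 1)
    (hfloor : ∀ i, (a (i + 1) : ℤ) = ⌊1 / β i⌋)
    (hβrec : ∀ i, β (i + 1) = 1 / β i - (a (i + 1) : ℝ)) (i : ℕ) :
    Irrational (β i) ∧ β i ∈ Set.Ioo (0 : ℝ) 1 := by
  induction i with
  | zero => exact ⟨hirr, h0⟩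
  | succ i ih =>
    have hirr' : Irrational (β (i + 1)) := by
      rw [hβrec, one_div]
      exact ih.1.inv.sub_natCast _
    have hfract : β (i + 1) = Int.fract (1 / β i) := by
      rw [hβrec, Int.fract, ← hfloor]
      simp
    refine ⟨hirr', lt_of_le_of_ne ?_ hirr'.ne_zero.symm, ?_⟩
    · exact hfract ▸ Int.fract_nonneg _
    · exact hfract ▸ Int.fract_lt_one _

/-- The product of the first `i + 1` tails is, up to sign, the error `h i - k i * α`. -/
theorem convergent_error {a h k : ℕ → ℕ} {β : ℕ → ℝ} (hβ : ∀ i, 0 < β i)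
    (hβrec : ∀ i, β (i + 1) = 1 / β i - (a (i + 1) : ℝ))
    (hh0 : h 0 = 0) (hk0 : k 0 = 1) (hh1 : h 1 = 1) (hk1 : k 1 = a 1)
    (hhrec : ∀ i, h (i + 2) = a (i + 2) * h (i + 1) + h i)
    (hkrec : ∀ i, k (i + 2) = a (i + 2) * k (i + 1) + k i) (i : ℕ) :
    (h i : ℝ) - k i * β 0 = (-1) ^ (i + 1) * ∏ j ∈ Finset.range (i + 1), β j := by
  induction i using Nat.twoStepInduction with
  | zero => simp [hh0, hk0]
  | one =>
    have := (hβ 0).ne'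
    simp only [hh1, hk1, Finset.prod_range_succ, hβrec 0]
    field_simp
    simp
  | more i ih ih' =>
    have h1 := (hβ (i + 1)).ne'
    have key : (∏ j ∈ Finset.range (i + 1), β j) * β (i + 1) * β (i + 2)
        = (∏ j ∈ Finset.range (i + 1), β j)
          - a (i + 2) * ((∏ j ∈ Finset.range (i + 1), β j) * β (i + 1)) := by
      rw [hβrec (i + 1)]
      field_simp
    rw [Finset.prod_range_succ] at ih'
    rw [hhrec, hkrec, Finset.prod_range_succ, Finset.prod_range_succ, key]
    push_cast
    linear_combination ih + a (i + 2) * ih'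

/-- Consecutive convergents have determinant `± 1`. -/
theorem convergent_det {a h k : ℕ → ℕ}
    (hh0 : h 0 = 0) (hk0 : k 0 = 1) (hh1 : h 1 = 1)
    (hhrec : ∀ i, h (i + 2) = a (i + 2) * h (i + 1) + h i)
    (hkrec : ∀ i, k (i + 2) = a (i + 2) * k (i + 1) + k i) (i : ℕ) :
    (h (i + 1) : ℤ) * k i - h i * k (i + 1) = (-1) ^ i := by
  induction i with
  | zero => simp [hh0, hk0, hh1]
  | succ i ih =>
    rw [hhrec, hkrec]
    push_cast
    linear_combination -ih

/-- Every positive integer lies between two consecutive numerators of the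
upper intermediate fractions. -/
theorem exists_upper_numerator_le_lt {a h : ℕ → ℕ} (hapos : ∀ i, 1 ≤ i → 1 ≤ a i)
    (hh0 : h 0 = 0) (hh1 : h 1 = 1)
    (hhrec : ∀ i, h (i + 2) = a (i + 2) * h (i + 1) + h i) {n : ℕ} (hn : 1 ≤ n) :
    ∃ r t : ℕ, t < a (2 * r + 3) ∧ h (2 * r + 1) + t * h (2 * r + 2) ≤ n ∧
      n < h (2 * r + 1) + (t + 1) * h (2 * r + 2) := by
  have hpos : ∀ i, 1 ≤ h (i + 1) := by
    intro i
    induction i using Nat.twoStepInduction with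
    | zero => exact hh1.ge
    | one =>
      rw [hhrec 0, hh0, hh1]
      simpa using hapos 2 (by norm_num)
    | more i ih ih' => rw [hhrec]; omega
  have hgrow : ∀ r, r < h (2 * r + 1) := by
    intro r
    induction r with
    | zero => simp [hh1]
    | succ r ih =>
      have h1 : h (2 * (r + 1) + 1) = a (2 * r + 3) * h (2 * r + 2) + h (2 * r + 1) :=
        hhrec (2 * r + 1)
      have h2 := Nat.mul_pos (hapos (2 * r + 3) (by omega)) (hpos (2 * r + 1))
      simp only [Nat.add_assoc, Nat.reduceAdd] at h2
      omega
  have hex : ∃ r, n < h (2 * r + 1) := ⟨n, hgrow n⟩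
  obtain ⟨r, hr⟩ : ∃ r, Nat.find hex = r + 1 := by
    refine Nat.exists_eq_succ_of_ne_zero fun h0 => ?_
    have := Nat.find_spec hex
    rw [h0] at this
    simp only [mul_zero, zero_add, hh1] at this
    omega
  have hlow : h (2 * r + 1) ≤ n := not_lt.mp (Nat.find_min hex (by omega : r < Nat.find hex))
  have hup : n < h (2 * r + 3) := by
    have := Nat.find_spec hex
    rwa [hr] at this
  rw [hhrec (2 * r + 1)] at hup
  have hdm := Nat.div_add_mod' (n - h (2 * r + 1)) (h (2 * r + 2))
  have hlt := Nat.mod_lt (n - h (2 * r + 1)) (hpos (2 * r + 1))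
  refine ⟨r, (n - h (2 * r + 1)) / h (2 * r + 2), ?_, ?_, ?_⟩
  · rw [Nat.div_lt_iff_lt_mul (hpos (2 * r + 1))]
    simp only [Nat.add_assoc, Nat.reduceAdd] at hup ⊢
    omega
  · omega
  · simp only [Nat.add_assoc, Nat.reduceAdd, add_mul, one_mul] at hlt ⊢
    omega

/-- If `(H, K)` and `(H', K')` form a unimodular pair of integer vectors on opposite sides of the
line of slope `α`, then a point `(n, m)` on the side of `(H, K)` with `n < H + H'` is a multiple
of `(H, K)` or lies further from the line than `(H, K)`. -/
theorem proportional_or_error_lt {α : ℝ} {H K H' K' n m : ℤ}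
    (hH : 0 ≤ H) (hH' : 0 ≤ H') (hn : 0 < n) (hlt : n < H + H')
    (hdet : H * K' - H' * K = 1) (hd : 0 < (H : ℝ) - K * α) (he : 0 < K' * α - H')
    (hD : 0 ≤ (n : ℝ) - m * α) :
    (∃ x : ℤ, 0 < x ∧ n = x * H ∧ m = x * K) ∨ (H : ℝ) - K * α < n - m * α := by
  obtain ⟨x, y, hx, hy⟩ : ∃ x y : ℤ, n = x * H + y * H' ∧ m = x * K + y * K' :=
    ⟨n * K' - m * H', m * H - n * K,
      by linear_combination -n * hdet, by linear_combination -m * hdet⟩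
  have hDeq : (n : ℝ) - m * α = x * ((H : ℝ) - K * α) - y * (K' * α - H') := by
    rw [hx, hy]
    push_cast
    ring
  rcases lt_trichotomy y 0 with hy0 | hy0 | hy0
  · right
    have hx1 : 1 ≤ x := by
      by_contra hx0
      nlinarith [mul_nonneg (by omega : 0 ≤ -x) hH, mul_nonneg (by omega : 0 ≤ -y) hH']
    have hx1' : (1 : ℝ) ≤ x := by exact_mod_cast hx1
    have hy0' : (y : ℝ) < 0 := by exact_mod_cast hy0
    rw [hDeq]
    nlinarith [mul_nonneg (sub_nonneg.mpr hx1') hd.le, mul_pos (neg_pos.mpr hy0') he]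
  · left
    subst hy0
    refine ⟨x, ?_, by linarith, by linarith⟩
    by_contra hx0
    nlinarith [mul_nonneg (by omega : 0 ≤ -x) hH]
  · exfalso
    have hy0' : (0 : ℝ) < y := by exact_mod_cast hy0
    have hx1 : 1 ≤ x := by
      by_contra hx0
      have hx0' : (x : ℝ) ≤ 0 := by exact_mod_cast (by omega : x ≤ 0)
      nlinarith [mul_pos hy0' he, mul_nonneg (neg_nonneg.mpr hx0') hd.le]
    nlinarith [mul_nonneg (sub_nonneg.mpr hx1) hH,
      mul_nonneg (sub_nonneg.mpr (by omega : 1 ≤ y)) hH']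

/- Context: α ∈ (0,1) irrational with simple continued fraction expansion
α = [0; a₁, a₂, …] computed by the usual algorithm (β i are the tails),
and hᵢ/kᵢ the convergents given by the standard recurrences. -/
theorem stmt_9 (α : ℝ) (hirr : Irrational α) (hα0 : 0 < α) (hα1 : α < 1)
    (a h k : ℕ → ℕ) (β : ℕ → ℝ)
    (ha0 : a 0 = 0) (hapos : ∀ i, 1 ≤ i → 1 ≤ a i)
    (hβ0 : β 0 = α)
    (hfloor : ∀ i, (a (i + 1) : ℤ) = ⌊1 / β i⌋)
    (hβrec : ∀ i, β (i + 1) = 1 / β i - (a (i + 1) : ℝ))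
    (hh0 : h 0 = 0) (hk0 : k 0 = 1) (hh1 : h 1 = 1) (hk1 : k 1 = a 1)
    (hhrec : ∀ i, h (i + 2) = a (i + 2) * h (i + 1) + h i)
    (hkrec : ∀ i, k (i + 2) = a (i + 2) * k (i + 1) + k i)
    (n : ℕ) (hn : 1 ≤ n)
    (hne : ∀ l t : ℕ, 1 ≤ l → t < a (2 * l + 1) →
      (n : ℚ) / ((⌊(n : ℝ) / α⌋ : ℤ) : ℚ)
        ≠ ((h (2 * l - 1) + t * h (2 * l) : ℕ) : ℚ)
            / ((k (2 * l - 1) + t * k (2 * l) : ℕ) : ℚ)) :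
    ∃ l t : ℕ, 1 ≤ l ∧ t < a (2 * l + 1) ∧
      h (2 * l - 1) + t * h (2 * l) < n ∧
      ((k (2 * l - 1) + t * k (2 * l) : ℕ) : ℤ) < ⌊(n : ℝ) / α⌋ ∧
      ((k (2 * l - 1) + t * k (2 * l) : ℕ) : ℤ)
          = ⌊((h (2 * l - 1) + t * h (2 * l) : ℕ) : ℝ) / α⌋ ∧
      (n : ℝ) - (⌊(n : ℝ) / α⌋ : ℝ) * α
        > ((h (2 * l - 1) + t * h (2 * l) : ℕ) : ℝ)
            - ((k (2 * l - 1) + t * k (2 * l) : ℕ) : ℝ) * α := by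
  have htail := tail_irrational_mem_Ioo_s9 (hβ0 ▸ hirr) (hβ0 ▸ ⟨hα0, hα1⟩) hfloor hβrec
  have hβpos : ∀ i, 0 < β i := fun i => (htail i).2.1
  set P : ℕ → ℝ := fun i => ∏ j ∈ Finset.range (i + 1), β j with hP
  have hPpos : ∀ i, 0 < P i := fun i => Finset.prod_pos fun j _ => hβpos j
  have hPanti : StrictAnti P := strictAnti_nat_of_succ_lt fun i => by
    rw [hP]
    dsimp only
    rw [Finset.prod_range_succ]
    exact mul_lt_of_lt_one_right (hPpos i) (htail (i + 1)).2.2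
  have hP0 : P 0 = α := by simp [hP, hβ0]
  have herr : ∀ i, (h i : ℝ) - k i * α = (-1) ^ (i + 1) * P i := fun i =>
    hβ0 ▸ convergent_error hβpos hβrec hh0 hk0 hh1 hk1 hhrec hkrec i
  obtain ⟨r, t, ht, hle, hlt⟩ := exists_upper_numerator_le_lt hapos hh0 hh1 hhrec hn
  have hdet := convergent_det hh0 hk0 hh1 hhrec hkrec (2 * r + 1)
  have hodd : (h (2 * r + 1) : ℝ) - k (2 * r + 1) * α = P (2 * r + 1) := by
    rw [herr, Even.neg_one_pow ⟨r + 1, by ring⟩, one_mul]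
  have heven : (k (2 * r + 2) : ℝ) * α - h (2 * r + 2) = P (2 * r + 2) := by
    rw [← neg_sub, herr, Odd.neg_one_pow ⟨r + 1, by ring⟩]
    ring
  have hodd' : (h (2 * r + 3) : ℝ) - k (2 * r + 3) * α = P (2 * r + 3) := by
    rw [herr, Even.neg_one_pow ⟨r + 2, by ring⟩, one_mul]
  rw [hhrec (2 * r + 1), hkrec (2 * r + 1)] at hodd'
  specialize hne (r + 1) t (by omega) ht
  refine ⟨r + 1, t, by omega, ht, ?_⟩
  simp only [show 2 * (r + 1) = 2 * r + 2 by omega,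
    show 2 * r + 2 - 1 = 2 * r + 1 by omega] at hne ⊢
  set H := h (2 * r + 1) + t * h (2 * r + 2) with hH
  set K := k (2 * r + 1) + t * k (2 * r + 2) with hK
  have hd : (H : ℝ) - K * α = P (2 * r + 1) - t * P (2 * r + 2) := by
    rw [hH, hK]
    push_cast
    linear_combination hodd - t * heven
  have htR : (t : ℝ) ≤ a (2 * r + 3) := by exact_mod_cast ht.le
  have hdpos : 0 < (H : ℝ) - K * α := by
    have hstep : P (2 * r + 3) = P (2 * r + 1) - a (2 * r + 3) * P (2 * r + 2) := by
      rw [← hodd', ← hodd, ← heven]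
      push_cast
      ring
    have := mul_le_mul_of_nonneg_right htR (hPpos (2 * r + 2)).le
    linarith [hPpos (2 * r + 3)]
  have hdα : (H : ℝ) - K * α < α := by
    have := hPanti (by omega : 0 < 2 * r + 1)
    have := mul_nonneg t.cast_nonneg (hPpos (2 * r + 2)).le
    linarith
  have hgH : (K : ℤ) = ⌊(H : ℝ) / α⌋ := by
    symm
    rw [Int.floor_eq_iff, le_div_iff₀ hα0, div_lt_iff₀ hα0]
    push_cast
    constructor <;> linarith
  have hfloor_le : (⌊(n : ℝ) / α⌋ : ℝ) * α ≤ n := (le_div_iff₀ hα0).mp (Int.floor_le _)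
  have hHn : H < n := by
    refine lt_of_le_of_ne hle fun hEq => hne ?_
    rw [← hEq, ← hgH, Int.cast_natCast]
  refine ⟨hHn, ?_, hgH, ?_⟩
  · rw [← Int.add_one_le_iff, Int.le_floor, le_div_iff₀ hα0]
    have : (H : ℝ) + 1 ≤ n := by exact_mod_cast hHn
    push_cast
    linarith
  · have hcases := proportional_or_error_lt (α := α) (H := H) (K := K) (H' := h (2 * r + 2))
      (K' := k (2 * r + 2)) (n := n) (m := ⌊(n : ℝ) / α⌋) (by positivity) (by positivity)
      (by exact_mod_cast hn) (by rw [add_mul, one_mul] at hlt; omega)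
      (by
        rw [Odd.neg_one_pow ⟨r, rfl⟩] at hdet
        rw [hH, hK]
        push_cast
        linear_combination -hdet)
      (by simpa using hdpos) (by simpa [heven] using hPpos (2 * r + 2))
      (by simpa using hfloor_le)
    rcases hcases with ⟨x, hx, hnx, hmx⟩ | hlt'
    · refine absurd ?_ hne
      have hnx' : (n : ℚ) = x * H := by exact_mod_cast hnx
      rw [hmx, hnx']
      push_cast
      exact mul_div_mul_left _ _ (Int.cast_ne_zero.mpr hx.ne')
    · simpa using hlt'
end

section
/- Define y_n = n − g(n)·α for n ≥ 1. For an integer n ≥ 2, one has y_n < y_m for all integers m with 1 ≤ m < n if and only if there exist l ≥ 1 and an integer t with 1 ≤ t ≤ a_{2l+1} such that n = h_{2l−1} + t·h_{2l}. In other words, beyond the initial index m₁ = 1 = h₁, the indices at which the sequence (y_n) attains a strict new minimum are exactly the numerators of the primary and secondary convergents h_{2l−1} + t·h_{2l}. -/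
/-- For a unimodular pair of integer vectors `(U, K)`, `(W, L)` with `U - K α > 0 > W - L α`, every
integer `0 < n < U + W` has all its nonnegative values `n - p α` at least `U - K α`. -/
theorem le_sub_mul_of_unimodular {α : ℝ} {U K W L n p : ℤ} (hdet : U * L - W * K = 1)
    (hU : 0 ≤ U) (hW : 0 ≤ W) (hE : 0 < (U : ℝ) - K * α) (hF : (W : ℝ) - L * α < 0)
    (hn : 0 < n) (hlt : n < U + W) (hp : 0 ≤ (n : ℝ) - p * α) :
    (U : ℝ) - K * α ≤ n - p * α := by
  by_contra! hcon
  obtain ⟨x, hx⟩ : ∃ x : ℤ, x = n * L - p * W := ⟨_, rfl⟩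
  obtain ⟨z, hz⟩ : ∃ z : ℤ, z = U * p - K * n := ⟨_, rfl⟩
  have hnxz : n = x * U + z * W := by
    rw [hx, hz]; linear_combination (-n) * hdet
  have hpxz : p = x * K + z * L := by
    rw [hx, hz]; linear_combination (-p) * hdet
  have hval : (n : ℝ) - p * α = x * (U - K * α) + z * (W - L * α) := by
    rw [hnxz, hpxz]; push_cast; ring
  rw [hval] at hp hcon
  have hx1 : 1 ≤ x := by
    by_contra! hx0
    have hx0' : (x : ℝ) ≤ 0 := by exact_mod_cast Int.lt_add_one_iff.mp hx0
    have hz0 : z ≤ 0 := by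
      by_contra! hz0
      have hz0' : (0 : ℝ) < z := by exact_mod_cast hz0
      nlinarith [mul_nonneg (neg_nonneg.mpr hx0') hE.le, mul_pos hz0' (neg_pos.mpr hF)]
    nlinarith
  have hz1 : 1 ≤ z := by
    by_contra! hz0
    have hz0' : (z : ℝ) ≤ 0 := by exact_mod_cast Int.lt_add_one_iff.mp hz0
    have hx1' : (1 : ℝ) ≤ x := by exact_mod_cast hx1
    nlinarith [mul_nonneg (sub_nonneg.mpr hx1') hE.le,
      mul_nonneg (neg_nonneg.mpr hz0') (neg_pos.mpr hF).le]
  nlinarith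


/- Context: α ∈ (0,1) irrational with simple continued fraction expansion
α = [0; a₁, a₂, …] computed by the usual algorithm (β i are the tails),
and hᵢ/kᵢ the convergents given by the standard recurrences. -/
theorem stmt_11 (α : ℝ) (hirr : Irrational α) (hα0 : 0 < α) (hα1 : α < 1)
    (a h k : ℕ → ℕ) (β : ℕ → ℝ)
    (ha0 : a 0 = 0) (hapos : ∀ i, 1 ≤ i → 1 ≤ a i)
    (hβ0 : β 0 = α)
    (hfloor : ∀ i, (a (i + 1) : ℤ) = ⌊1 / β i⌋)
    (hβrec : ∀ i, β (i + 1) = 1 / β i - (a (i + 1) : ℝ))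
    (hh0 : h 0 = 0) (hk0 : k 0 = 1) (hh1 : h 1 = 1) (hk1 : k 1 = a 1)
    (hhrec : ∀ i, h (i + 2) = a (i + 2) * h (i + 1) + h i)
    (hkrec : ∀ i, k (i + 2) = a (i + 2) * k (i + 1) + k i)
    (y : ℕ → ℝ)
    (hy : ∀ n : ℕ, 1 ≤ n → y n = (n : ℝ) - (⌊(n : ℝ) / α⌋ : ℝ) * α) :
    ∀ n : ℕ, 2 ≤ n →
      ((∀ m : ℕ, 1 ≤ m → m < n → y n < y m) ↔
        ∃ l t : ℕ, 1 ≤ l ∧ 1 ≤ t ∧ t ≤ a (2 * l + 1) ∧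
          n = h (2 * l - 1) + t * h (2 * l)) := by
  have hβ : ∀ i, Irrational (β i) ∧ 0 < β i ∧ β i < 1 := by
    intro i
    induction i with
    | zero => exact hβ0 ▸ ⟨hirr, hα0, hα1⟩
    | succ i ih =>
      have hfract : β (i + 1) = Int.fract (1 / β i) := by
        rw [hβrec, Int.fract, ← hfloor, Int.cast_natCast]
      have hirr' : Irrational (β (i + 1)) := by
        rw [hβrec, one_div]
        exact ih.1.inv.sub_natCast _
      refine ⟨hirr', lt_of_le_of_ne ?_ hirr'.ne_zero.symm, ?_⟩
      · rw [hfract]; exact Int.fract_nonneg _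
      · rw [hfract]; exact Int.fract_lt_one _
  obtain ⟨e, he⟩ : ∃ e : ℕ → ℝ, ∀ i, e i = h i - k i * α := ⟨_, fun _ => rfl⟩
  have herec : ∀ i, e (i + 2) = a (i + 2) * e (i + 1) + e i := by
    intro i
    rw [he, he, he, hhrec, hkrec]; push_cast; ring
  have hestep : ∀ i, e (i + 1) = -(β (i + 1) * e i) := by
    intro i
    induction i with
    | zero =>
      rw [he, he, hβrec, hβ0, zero_add, hh1, hk1, hh0, hk0]
      push_cast
      field_simp
      ring
    | succ i ih =>
      have hne := (hβ (i + 1)).2.1.ne'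
      rw [herec, hβrec (i + 1), ih]
      field_simp
      ring
  have hsign : ∀ j, 0 < e (2 * j + 1) ∧ e (2 * j + 1) < α ∧ e (2 * j + 2) < 0 := by
    have hodd : ∀ j, 0 < e (2 * j + 1) ∧ e (2 * j + 1) < α := by
      intro j
      induction j with
      | zero =>
        have h0 : e 0 = -α := by rw [he, hh0, hk0]; simp
        have h1 : e (2 * 0 + 1) = β 1 * α := by rw [mul_zero, hestep, h0]; ring
        rw [h1]
        exact ⟨mul_pos (hβ 1).2.1 hα0, by nlinarith [(hβ 1).2.2]⟩
      | succ j ih =>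
        have h1 : e (2 * (j + 1) + 1) = β (2 * j + 3) * β (2 * j + 2) * e (2 * j + 1) := by
          rw [show 2 * (j + 1) + 1 = 2 * j + 2 + 1 by ring, hestep, hestep (2 * j + 1)]; ring
        have hb := mul_pos (hβ (2 * j + 3)).2.1 (hβ (2 * j + 2)).2.1
        have hb' : β (2 * j + 3) * β (2 * j + 2) < 1 :=
          mul_lt_one_of_nonneg_of_lt_one_left (hβ _).2.1.le (hβ _).2.2 (hβ _).2.2.le
        rw [h1]
        exact ⟨mul_pos hb ih.1, by nlinarith [ih.1, ih.2]⟩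
    intro j
    refine ⟨(hodd j).1, (hodd j).2, ?_⟩
    rw [hestep (2 * j + 1)]
    exact neg_lt_zero.mpr (mul_pos (hβ _).2.1 (hodd j).1)
  have hdet : ∀ j, (h (2 * j + 1) : ℤ) * k (2 * j + 2) - h (2 * j + 2) * k (2 * j + 1) = 1 := by
    intro j
    induction j with
    | zero =>
      simp only [mul_zero, zero_add, hhrec 0, hkrec 0, hh0, hk0, hh1, hk1]
      push_cast; ring
    | succ j ih =>
      have e1 := hhrec (2 * j + 1)
      have e2 := hkrec (2 * j + 1)
      have e3 := hhrec (2 * j + 2)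
      have e4 := hkrec (2 * j + 2)
      rw [show 2 * (j + 1) + 1 = 2 * j + 1 + 2 by ring,
        show 2 * (j + 1) + 2 = 2 * j + 2 + 2 by ring, e3, e4]
      rw [show 2 * j + 2 + 1 = 2 * j + 1 + 2 by ring, e1, e2]
      push_cast
      linear_combination ih
  have hpos : ∀ i, 1 ≤ h (i + 1) := by
    intro i
    induction i with
    | zero => exact hh1.ge
    | succ i ih =>
      rw [hhrec]
      nlinarith [hapos (i + 2) (by omega), Nat.zero_le (h i)]
  have hvalue : ∀ j s, s ≤ a (2 * j + 3) →
      0 < e (2 * j + 1) + s * e (2 * j + 2) ∧ e (2 * j + 1) + s * e (2 * j + 2) < α := by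
    intro j s hs
    have hs' : (s : ℝ) ≤ a (2 * j + 3) := by exact_mod_cast hs
    have h3 := (hsign (j + 1)).1
    rw [show 2 * (j + 1) + 1 = 2 * j + 1 + 2 by ring, herec] at h3
    have hs0 : (0 : ℝ) ≤ s := s.cast_nonneg
    obtain ⟨-, h1, h2⟩ := hsign j
    exact ⟨by nlinarith, by nlinarith⟩
  have hcomb : ∀ j s : ℕ, ((h (2 * j + 1) + s * h (2 * j + 2) : ℕ) : ℝ) -
      ((k (2 * j + 1) + s * k (2 * j + 2) : ℕ) : ℝ) * α =
      e (2 * j + 1) + s * e (2 * j + 2) := by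
    intro j s
    rw [he, he]; push_cast; ring
  have hyval : ∀ j s, s ≤ a (2 * j + 3) →
      y (h (2 * j + 1) + s * h (2 * j + 2)) = e (2 * j + 1) + s * e (2 * j + 2) := by
    intro j s hs
    rw [hy _ (le_add_right (hpos _)), ← hcomb]
    obtain ⟨h1, h2⟩ := hvalue j s hs
    rw [← hcomb] at h1 h2
    generalize h (2 * j + 1) + s * h (2 * j + 2) = n at *
    generalize k (2 * j + 1) + s * k (2 * j + 2) = p at *
    have hp : ⌊(n : ℝ) / α⌋ = (p : ℤ) := by
      rw [Int.floor_eq_iff, le_div_iff₀ hα0, div_lt_iff₀ hα0]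
      push_cast
      exact ⟨by linarith, by linarith⟩
    rw [hp, Int.cast_natCast]
  have hlower : ∀ j s n, s ≤ a (2 * j + 3) → 1 ≤ n →
      n < h (2 * j + 1) + (s + 1) * h (2 * j + 2) →
      e (2 * j + 1) + s * e (2 * j + 2) ≤ y n := by
    intro j s n hs hn hlt
    have hE := (hvalue j s hs).1
    rw [← hcomb] at hE ⊢
    have hF := (hsign j).2.2
    rw [he] at hF
    rw [hy n hn]
    have hfl : (⌊(n : ℝ) / α⌋ : ℝ) * α ≤ n := by
      rw [← le_div_iff₀ hα0]; exact Int.floor_le _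
    have hd : ((h (2 * j + 1) + s * h (2 * j + 2) : ℕ) : ℤ) * (k (2 * j + 2) : ℕ) -
        (h (2 * j + 2) : ℕ) * ((k (2 * j + 1) + s * k (2 * j + 2) : ℕ) : ℤ) = 1 := by
      push_cast
      linear_combination hdet j
    have hlt' : (n : ℤ) < ((h (2 * j + 1) + s * h (2 * j + 2) : ℕ) : ℤ) + (h (2 * j + 2) : ℕ) := by
      have : n < h (2 * j + 1) + s * h (2 * j + 2) + h (2 * j + 2) := by linarith
      exact_mod_cast this
    have := le_sub_mul_of_unimodular (α := α) (n := n) (p := ⌊(n : ℝ) / α⌋) hd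
      (Int.natCast_nonneg _) (Int.natCast_nonneg _) (by exact_mod_cast hE)
      (by exact_mod_cast hF) (by exact_mod_cast hn) hlt' (by simpa using hfl)
    simpa only [Int.cast_natCast] using this
  have hgrow : ∀ j, j + 1 ≤ h (2 * j + 1) := by
    intro j
    induction j with
    | zero => exact hpos 0
    | succ j ih =>
      rw [show 2 * (j + 1) + 1 = 2 * j + 1 + 2 by ring, hhrec]
      nlinarith [hapos (2 * j + 1 + 2) (by omega), hpos (2 * j + 1)]
  have hblock : ∀ j s n, s ≤ a (2 * j + 3) → n ≤ h (2 * j + 1) + s * h (2 * j + 2) →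
      (∀ m : ℕ, 1 ≤ m → m < n → y n < y m) → h (2 * j + 1) < n →
      ∃ t, 1 ≤ t ∧ t ≤ a (2 * j + 3) ∧ n = h (2 * j + 1) + t * h (2 * j + 2) := by
    intro j s
    induction s with
    | zero => intro n _ hle _ hgt; omega
    | succ s ih =>
      intro n hs hle hn hgt
      rcases hle.eq_or_lt with heq | hlt
      · exact ⟨s + 1, by omega, hs, heq⟩
      rcases le_or_gt n (h (2 * j + 1) + s * h (2 * j + 2)) with hle' | hgt'
      · exact ih n (by omega) hle' hn hgt
      · have h1 := hlower j s n (by omega) (by omega) hlt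
        have h2 := hn _ (le_add_right (hpos _)) hgt'
        rw [hyval j s (by omega)] at h2
        linarith
  have hrecord : ∀ j n, 2 ≤ n → n ≤ h (2 * j + 1) →
      (∀ m : ℕ, 1 ≤ m → m < n → y n < y m) →
      ∃ i t, 1 ≤ t ∧ t ≤ a (2 * i + 3) ∧ n = h (2 * i + 1) + t * h (2 * i + 2) := by
    intro j
    induction j with
    | zero => intro n h2 hle _; rw [mul_zero, zero_add, hh1] at hle; omega
    | succ j ih =>
      intro n h2 hle hn
      rcases le_or_gt n (h (2 * j + 1)) with hle' | hgt
      · exact ih n h2 hle' hn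
      · rw [show 2 * (j + 1) + 1 = 2 * j + 1 + 2 by ring, hhrec, add_comm] at hle
        exact ⟨j, hblock j _ n le_rfl hle hn hgt⟩
  intro n hn
  constructor
  · intro hrec
    obtain ⟨i, t, ht1, ht2, hnt⟩ := hrecord n n hn (n.le_succ.trans (hgrow n)) hrec
    exact ⟨i + 1, t, by omega, ht1, ht2, hnt⟩
  · rintro ⟨l, t, hl, ht1, ht2, rfl⟩ m hm hlt
    obtain ⟨j, rfl⟩ := Nat.exists_eq_add_of_le' hl
    obtain ⟨s, rfl⟩ := Nat.exists_eq_add_of_le' ht1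
    have ht : s + 1 ≤ a (2 * j + 3) := ht2
    have h1 := hlower j s m (by omega) hm hlt
    have h2 : y (h (2 * (j + 1) - 1) + (s + 1) * h (2 * (j + 1))) = _ := hyval j (s + 1) ht
    rw [h2]
    push_cast
    linarith [(hsign j).2.2]
end

section
/- For every pair (x, y) of nonnegative integers, exactly one of the following holds: (i) there exist j ≥ 0 and an integer t with 0 ≤ t < a_{2j+2} such that h_{2j} + t·h_{2j+1} ≤ y < h_{2j} + (t+1)·h_{2j+1} and 0 ≤ x < k_{2j+1}; or (ii) there exist i ≥ 1 and an integer t with 0 ≤ t < a_{2i+1} such that k_{2i−1} + t·k_{2i} ≤ x < k_{2i−1} + (t+1)·k_{2i} and 0 ≤ y < h_{2i}. Moreover, in each case the parameters (j, t) respectively (i, t) are uniquely determined by (x, y). (Equivalently, the rectangles □P_iᵗQ_iᵗR_iᵗS_iᵗ and □A_iᵗB_iᵗC_iᵗD_iᵗ form a partition of the grid (ℕ ∪ {0}) × (ℕ ∪ {0}).) -/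
theorem StrictMono.exists_le_and_lt_succ {f : ℕ → ℕ} (hf : StrictMono f) (h0 : f 0 = 0) (y : ℕ) :
    ∃ n, f n ≤ y ∧ y < f (n + 1) := by
  induction y with
  | zero => exact ⟨0, h0.le, h0.symm.trans_lt (hf Nat.zero_lt_one)⟩
  | succ y ih =>
    obtain ⟨n, hn, hn'⟩ := ih
    rcases Nat.lt_or_ge (y + 1) (f (n + 1)) with h | h
    · exact ⟨n, by omega, h⟩
    · exact ⟨n + 1, h, lt_of_le_of_lt hn' (hf (Nat.lt_succ_self (n + 1)))⟩

theorem Nat.exists_lt_block_iff {a c d y : ℕ} (hd : 0 < d) :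
    (∃ t < a, c + t * d ≤ y ∧ y < c + (t + 1) * d) ↔ c ≤ y ∧ y < a * d + c := by
  constructor
  · rintro ⟨t, ht, h, h'⟩
    have := Nat.mul_le_mul_right d (Nat.succ_le_of_lt ht)
    rw [Nat.succ_eq_add_one] at this
    omega
  · rintro ⟨h, h'⟩
    refine ⟨(y - c) / d, (Nat.div_lt_iff_lt_mul hd).2 (by omega), ?_, ?_⟩
    · have := Nat.div_mul_le_self (y - c) d
      omega
    · have := Nat.lt_mul_of_div_lt (Nat.lt_succ_self ((y - c) / d)) hd
      rw [Nat.succ_eq_add_one] at this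
      omega

theorem Nat.block_unique {c d y t t' : ℕ} (h : c + t * d ≤ y) (h' : y < c + (t + 1) * d)
    (g : c + t' * d ≤ y) (g' : y < c + (t' + 1) * d) : t = t' := by
  have h₁ : t < t' + 1 := Nat.lt_of_mul_lt_mul_right (a := d) (by omega)
  have h₂ : t' < t + 1 := Nat.lt_of_mul_lt_mul_right (a := d) (by omega)
  omega

/- Context: α ∈ (0,1) irrational with simple continued fraction expansion
α = [0; a₁, a₂, …] computed by the usual algorithm (β i are the tails),
and hᵢ/kᵢ the convergents given by the standard recurrences. -/
theorem stmt_14 (α : ℝ) (hirr : Irrational α) (hα0 : 0 < α) (hα1 : α < 1)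
    (a h k : ℕ → ℕ) (β : ℕ → ℝ)
    (ha0 : a 0 = 0) (hapos : ∀ i, 1 ≤ i → 1 ≤ a i)
    (hβ0 : β 0 = α)
    (hfloor : ∀ i, (a (i + 1) : ℤ) = ⌊1 / β i⌋)
    (hβrec : ∀ i, β (i + 1) = 1 / β i - (a (i + 1) : ℝ))
    (hh0 : h 0 = 0) (hk0 : k 0 = 1) (hh1 : h 1 = 1) (hk1 : k 1 = a 1)
    (hhrec : ∀ i, h (i + 2) = a (i + 2) * h (i + 1) + h i)
    (hkrec : ∀ i, k (i + 2) = a (i + 2) * k (i + 1) + k i) :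
    ∀ x y : ℕ,
      Xor'
        (∃ j t : ℕ, t < a (2 * j + 2) ∧
          h (2 * j) + t * h (2 * j + 1) ≤ y ∧
          y < h (2 * j) + (t + 1) * h (2 * j + 1) ∧ x < k (2 * j + 1))
        (∃ i t : ℕ, 1 ≤ i ∧ t < a (2 * i + 1) ∧
          k (2 * i - 1) + t * k (2 * i) ≤ x ∧
          x < k (2 * i - 1) + (t + 1) * k (2 * i) ∧ y < h (2 * i)) ∧
      (∀ j t j' t' : ℕ,
        (t < a (2 * j + 2) ∧ h (2 * j) + t * h (2 * j + 1) ≤ y ∧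
          y < h (2 * j) + (t + 1) * h (2 * j + 1) ∧ x < k (2 * j + 1)) →
        (t' < a (2 * j' + 2) ∧ h (2 * j') + t' * h (2 * j' + 1) ≤ y ∧
          y < h (2 * j') + (t' + 1) * h (2 * j' + 1) ∧ x < k (2 * j' + 1)) →
        j = j' ∧ t = t') ∧
      (∀ i t i' t' : ℕ,
        (1 ≤ i ∧ t < a (2 * i + 1) ∧ k (2 * i - 1) + t * k (2 * i) ≤ x ∧
          x < k (2 * i - 1) + (t + 1) * k (2 * i) ∧ y < h (2 * i)) →
        (1 ≤ i' ∧ t' < a (2 * i' + 1) ∧ k (2 * i' - 1) + t' * k (2 * i') ≤ x ∧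
          x < k (2 * i' - 1) + (t' + 1) * k (2 * i') ∧ y < h (2 * i')) →
        i = i' ∧ t = t') := by
  have hpos : ∀ n, 0 < h (2 * n + 1) := by
    intro n
    induction n with
    | zero => simp [hh1]
    | succ n ih =>
      have := hhrec (2 * n + 1)
      rw [show 2 * (n + 1) + 1 = 2 * n + 1 + 2 by ring]
      omega
  have kpos : ∀ n, 0 < k (2 * n) := by
    intro n
    induction n with
    | zero => simp [hk0]
    | succ n ih =>
      have := hkrec (2 * n)
      rw [show 2 * (n + 1) = 2 * n + 2 by ring]
      omega
  have krec : ∀ i, 1 ≤ i → k (2 * i + 1) = a (2 * i + 1) * k (2 * i) + k (2 * i - 1) := by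
    intro i hi
    have := hkrec (2 * i - 1)
    rwa [show 2 * i - 1 + 2 = 2 * i + 1 by omega, show 2 * i - 1 + 1 = 2 * i by omega] at this
  have hmono : StrictMono fun n => h (2 * n) := by
    refine strictMono_nat_of_lt_succ fun n => ?_
    have := Nat.mul_pos (hapos (2 * n + 2) (by omega)) (hpos n)
    have := hhrec (2 * n)
    change h (2 * n) < h (2 * n + 2)
    omega
  set g : ℕ → ℕ := fun n => if n = 0 then 0 else k (2 * n - 1) with hg
  have gsucc : ∀ n, g (n + 1) = k (2 * n + 1) := fun n => by simp [hg, Nat.mul_add]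
  have gpos : ∀ n, 1 ≤ n → g n = k (2 * n - 1) := fun n hn => by
    simp [hg, Nat.one_le_iff_ne_zero.1 hn]
  have gmono : StrictMono g := by
    refine strictMono_nat_of_lt_succ fun n => ?_
    rw [gsucc]
    rcases Nat.eq_zero_or_pos n with rfl | hn
    · simpa [hg, hk1] using Nat.lt_of_succ_le (hapos 1 le_rfl)
    · have := Nat.mul_pos (hapos (2 * n + 1) (by omega)) (kpos n)
      rw [krec n hn, gpos n hn]
      omega
  have row : ∀ j y, (∃ t < a (2 * j + 2), h (2 * j) + t * h (2 * j + 1) ≤ y ∧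
      y < h (2 * j) + (t + 1) * h (2 * j + 1)) ↔ h (2 * j) ≤ y ∧ y < h (2 * (j + 1)) := by
    intro j y
    rw [Nat.exists_lt_block_iff (hpos j), ← hhrec, Nat.mul_add]
  have col : ∀ i x, 1 ≤ i → ((∃ t < a (2 * i + 1), k (2 * i - 1) + t * k (2 * i) ≤ x ∧
      x < k (2 * i - 1) + (t + 1) * k (2 * i)) ↔ g i ≤ x ∧ x < g (i + 1)) := by
    intro i x hi
    rw [Nat.exists_lt_block_iff (kpos i), ← krec i hi, gsucc, gpos i hi]
  have uniq : ∀ {f : ℕ → ℕ} {m n z : ℕ}, StrictMono f → f m ≤ z → z < f (m + 1) →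
      f n ≤ z → z < f (n + 1) → m = n := by
    intro f m n z hf h₁ h₂ h₃ h₄
    have := hf.lt_iff_lt.1 (h₁.trans_lt h₄)
    have := hf.lt_iff_lt.1 (h₃.trans_lt h₂)
    omega
  intro x y
  obtain ⟨n, hn, hn'⟩ := hmono.exists_le_and_lt_succ (by simpa using hh0) y
  obtain ⟨m, hm, hm'⟩ := gmono.exists_le_and_lt_succ (by simp [hg]) x
  have first : (∃ j t : ℕ, t < a (2 * j + 2) ∧ h (2 * j) + t * h (2 * j + 1) ≤ y ∧
      y < h (2 * j) + (t + 1) * h (2 * j + 1) ∧ x < k (2 * j + 1)) ↔ m ≤ n := by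
    constructor
    · rintro ⟨j, t, ht, h₁, h₂, h₃⟩
      obtain ⟨hj, hj'⟩ := (row j y).1 ⟨t, ht, h₁, h₂⟩
      obtain rfl := uniq hmono hn hn' hj hj'
      rw [← gsucc] at h₃
      exact Nat.lt_succ_iff.1 (gmono.lt_iff_lt.1 (hm.trans_lt h₃))
    · intro hmn
      obtain ⟨t, ht, h₁, h₂⟩ := (row n y).2 ⟨hn, hn'⟩
      refine ⟨n, t, ht, h₁, h₂, ?_⟩
      rw [← gsucc]
      exact hm'.trans_le (gmono.monotone (by omega))
  have second : (∃ i t : ℕ, 1 ≤ i ∧ t < a (2 * i + 1) ∧ k (2 * i - 1) + t * k (2 * i) ≤ x ∧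
      x < k (2 * i - 1) + (t + 1) * k (2 * i) ∧ y < h (2 * i)) ↔ n < m := by
    constructor
    · rintro ⟨i, t, hi, ht, h₁, h₂, h₃⟩
      obtain ⟨hi₁, hi₂⟩ := (col i x hi).1 ⟨t, ht, h₁, h₂⟩
      obtain rfl := uniq gmono hm hm' hi₁ hi₂
      exact hmono.lt_iff_lt.1 (hn.trans_lt h₃)
    · intro hnm
      obtain ⟨t, ht, h₁, h₂⟩ := (col m x (by omega)).2 ⟨hm, hm'⟩
      exact ⟨m, t, by omega, ht, h₁, h₂, hn'.trans_le (hmono.monotone hnm)⟩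
  refine ⟨?_, ?_, ?_⟩
  · rw [first, second, ← not_le]
    exact xor_not_right.2 Iff.rfl
  · rintro j t j' t' ⟨ht, h₁, h₂, -⟩ ⟨ht', h₁', h₂', -⟩
    obtain ⟨hj, hj'⟩ := (row j y).1 ⟨t, ht, h₁, h₂⟩
    obtain ⟨hl, hl'⟩ := (row j' y).1 ⟨t', ht', h₁', h₂'⟩
    obtain rfl := uniq hmono hj hj' hl hl'
    exact ⟨rfl, Nat.block_unique h₁ h₂ h₁' h₂'⟩
  · rintro i t i' t' ⟨hi, ht, h₁, h₂, -⟩ ⟨hi', ht', h₁', h₂', -⟩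
    obtain ⟨hj, hj'⟩ := (col i x hi).1 ⟨t, ht, h₁, h₂⟩
    obtain ⟨hl, hl'⟩ := (col i' x hi').1 ⟨t', ht', h₁', h₂'⟩
    obtain rfl := uniq gmono hj hj' hl hl'
    exact ⟨rfl, Nat.block_unique h₁ h₂ h₁' h₂'⟩
end

section
/- For every pair (x, y) of nonnegative integers with (x, y) ≠ (0, 0), exactly one of the following holds: (i) there exist i ≥ 1 and an integer t with 0 ≤ t < a_{2i+1} such that 0 ≤ x < k_{2i} and h_{2i−1} + t·h_{2i} ≤ y < h_{2i−1} + (t+1)·h_{2i}; or (ii) there exist i ≥ 0 and an integer t with 0 ≤ t < a_{2i+2} such that k_{2i} + t·k_{2i+1} ≤ x < k_{2i} + (t+1)·k_{2i+1} and 0 ≤ y < h_{2i+1}. Moreover, in each case the parameters (i, t) are uniquely determined by (x, y). (Equivalently, the translated rectangles □Ã_iᵗB̃_iᵗC̃_iᵗD̃_iᵗ and □P̃_iᵗQ̃_iᵗR̃_iᵗS̃_iᵗ form a partition of the grid (ℕ ∪ {0}) × (ℕ ∪ {0}) with the origin removed.) -/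
theorem exists_block_of_lt {b n d y : ℕ} (hb : b ≤ y) (hy : y < n * d + b) :
    ∃ t < n, b + t * d ≤ y ∧ y < b + (t + 1) * d := by
  have hd : 0 < d := by
    rcases Nat.eq_zero_or_pos d with rfl | hd
    · omega
    · exact hd
  refine ⟨(y - b) / d, (Nat.div_lt_iff_lt_mul hd).2 (by omega), ?_, ?_⟩
  · have := Nat.div_mul_le_self (y - b) d
    omega
  · have := Nat.lt_mul_of_div_lt (Nat.lt_succ_self ((y - b) / d)) hd
    simp only [Nat.succ_eq_add_one] at this
    omega

theorem block_le {b n d y t : ℕ} (ht : t < n) (h1 : b + t * d ≤ y)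
    (h2 : y < b + (t + 1) * d) : b ≤ y ∧ y < n * d + b := by
  have := Nat.mul_le_mul_right d (Nat.succ_le_of_lt ht)
  simp only [Nat.succ_eq_add_one] at this
  omega

theorem block_unique {b d y t s : ℕ} (h1 : b + t * d ≤ y) (h2 : y < b + (t + 1) * d)
    (h3 : b + s * d ≤ y) (h4 : y < b + (s + 1) * d) : t = s := by
  have h5 : t * d < (s + 1) * d := by omega
  have h6 : s * d < (t + 1) * d := by omega
  have := Nat.lt_of_mul_lt_mul_right h5
  have := Nat.lt_of_mul_lt_mul_right h6
  omega

theorem StrictMono.index_unique {f : ℕ → ℕ} (hf : StrictMono f) {x i j : ℕ}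
    (h1 : f i ≤ x) (h2 : x < f (i + 1)) (h3 : f j ≤ x) (h4 : x < f (j + 1)) : i = j := by
  have := hf.lt_iff_lt.1 (h1.trans_lt h4)
  have := hf.lt_iff_lt.1 (h3.trans_lt h2)
  omega

/-- The L-shaped regions cut out by two strictly increasing sequences starting at `1`
cover the grid without the origin. -/
theorem StrictMono.exists_staircase {K H : ℕ → ℕ} (hK : StrictMono K) (hH : StrictMono H)
    (hK0 : K 0 = 1) (hH0 : H 0 = 1) {x y : ℕ} (hxy : ¬(x = 0 ∧ y = 0)) :
    (∃ j, x < K (j + 1) ∧ H j ≤ y ∧ y < H (j + 1)) ∨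
      ∃ i, K i ≤ x ∧ x < K (i + 1) ∧ y < H i := by
  have ex : ∃ p, x < K p := ⟨x + 1, hK.le_apply⟩
  have ey : ∃ q, y < H q := ⟨y + 1, hH.le_apply⟩
  classical
  obtain ⟨p, hp, hp'⟩ : ∃ p, x < K p ∧ ∀ m < p, K m ≤ x :=
    ⟨Nat.find ex, Nat.find_spec ex, fun m hm => not_lt.1 (Nat.find_min ex hm)⟩
  obtain ⟨q, hq, hq'⟩ : ∃ q, y < H q ∧ ∀ m < q, H m ≤ y :=
    ⟨Nat.find ey, Nat.find_spec ey, fun m hm => not_lt.1 (Nat.find_min ey hm)⟩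
  rcases le_or_gt p q with hpq | hpq
  · cases q with
    | zero =>
      obtain rfl : p = 0 := by omega
      omega
    | succ j => exact .inl ⟨j, hp.trans_le (hK.monotone hpq), hq' j j.lt_succ_self, hq⟩
  · cases p with
    | zero => omega
    | succ i =>
      exact .inr ⟨i, hp' i i.lt_succ_self, hp, hq.trans_le (hH.monotone (by omega))⟩

theorem pos_of_linear_recurrence {a u : ℕ → ℕ} (m : ℕ) (h0 : 0 < u m) (h1 : 0 < u (m + 1))
    (hrec : ∀ i, u (i + 2) = a (i + 2) * u (i + 1) + u i) (n : ℕ) :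
    0 < u (m + n) ∧ 0 < u (m + n + 1) := by
  induction n with
  | zero => exact ⟨h0, h1⟩
  | succ n ih => exact ⟨ih.2, by rw [← Nat.add_assoc, hrec]; omega⟩

/- Context: α ∈ (0,1) irrational with simple continued fraction expansion
α = [0; a₁, a₂, …] computed by the usual algorithm (β i are the tails),
and hᵢ/kᵢ the convergents given by the standard recurrences. -/
theorem stmt_15 (α : ℝ) (hirr : Irrational α) (hα0 : 0 < α) (hα1 : α < 1)
    (a h k : ℕ → ℕ) (β : ℕ → ℝ)
    (ha0 : a 0 = 0) (hapos : ∀ i, 1 ≤ i → 1 ≤ a i)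
    (hβ0 : β 0 = α)
    (hfloor : ∀ i, (a (i + 1) : ℤ) = ⌊1 / β i⌋)
    (hβrec : ∀ i, β (i + 1) = 1 / β i - (a (i + 1) : ℝ))
    (hh0 : h 0 = 0) (hk0 : k 0 = 1) (hh1 : h 1 = 1) (hk1 : k 1 = a 1)
    (hhrec : ∀ i, h (i + 2) = a (i + 2) * h (i + 1) + h i)
    (hkrec : ∀ i, k (i + 2) = a (i + 2) * k (i + 1) + k i) :
    ∀ x y : ℕ, ¬(x = 0 ∧ y = 0) →
      Xor'
        (∃ i t : ℕ, 1 ≤ i ∧ t < a (2 * i + 1) ∧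
          x < k (2 * i) ∧ h (2 * i - 1) + t * h (2 * i) ≤ y ∧
          y < h (2 * i - 1) + (t + 1) * h (2 * i))
        (∃ i t : ℕ, t < a (2 * i + 2) ∧
          k (2 * i) + t * k (2 * i + 1) ≤ x ∧
          x < k (2 * i) + (t + 1) * k (2 * i + 1) ∧ y < h (2 * i + 1)) ∧
      (∀ i t i' t' : ℕ,
        (1 ≤ i ∧ t < a (2 * i + 1) ∧ x < k (2 * i) ∧
          h (2 * i - 1) + t * h (2 * i) ≤ y ∧
          y < h (2 * i - 1) + (t + 1) * h (2 * i)) →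
        (1 ≤ i' ∧ t' < a (2 * i' + 1) ∧ x < k (2 * i') ∧
          h (2 * i' - 1) + t' * h (2 * i') ≤ y ∧
          y < h (2 * i' - 1) + (t' + 1) * h (2 * i')) →
        i = i' ∧ t = t') ∧
      (∀ i t i' t' : ℕ,
        (t < a (2 * i + 2) ∧ k (2 * i) + t * k (2 * i + 1) ≤ x ∧
          x < k (2 * i) + (t + 1) * k (2 * i + 1) ∧ y < h (2 * i + 1)) →
        (t' < a (2 * i' + 2) ∧ k (2 * i') + t' * k (2 * i' + 1) ≤ x ∧
          x < k (2 * i') + (t' + 1) * k (2 * i' + 1) ∧ y < h (2 * i' + 1)) →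
        i = i' ∧ t = t') := by
  have ha (i : ℕ) : 0 < a (i + 1) := hapos _ (by omega)
  have hkpos (n : ℕ) : 0 < k n := by
    have := (pos_of_linear_recurrence 0 (by omega) (by simpa [hk1] using ha 0) hkrec n).1
    rwa [Nat.zero_add] at this
  have hhpos (n : ℕ) : 0 < h (n + 1) := by
    have := (pos_of_linear_recurrence 1 (by omega) (by rw [hhrec 0]; simp [hh0, hh1, ha 1])
      hhrec n).1
    rwa [Nat.add_comm] at this
  have hK : StrictMono fun i => k (2 * i) := strictMono_nat_of_lt_succ fun i => by
    have := Nat.mul_pos (ha (2 * i + 1)) (hkpos (2 * i + 1))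
    have := hkrec (2 * i)
    simp only [Nat.mul_add, Nat.mul_one, Nat.add_assoc, Nat.reduceAdd] at *
    omega
  have hH : StrictMono fun i => h (2 * i + 1) := strictMono_nat_of_lt_succ fun i => by
    have := Nat.mul_pos (ha (2 * i + 2)) (hhpos (2 * i + 1))
    have := hhrec (2 * i + 1)
    simp only [Nat.mul_add, Nat.mul_one, Nat.add_assoc, Nat.reduceAdd] at *
    omega
  have hKs (i : ℕ) : k (2 * (i + 1)) = a (2 * i + 2) * k (2 * i + 1) + k (2 * i) := hkrec (2 * i)
  have hHs (j : ℕ) : h (2 * (j + 1) + 1) =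
      a (2 * (j + 1) + 1) * h (2 * (j + 1)) + h (2 * j + 1) := hhrec (2 * j + 1)
  have hsub (j : ℕ) : 2 * (j + 1) - 1 = 2 * j + 1 := by omega
  intro x y hxy
  have upper {i t : ℕ} (H : 1 ≤ i ∧ t < a (2 * i + 1) ∧ x < k (2 * i) ∧
      h (2 * i - 1) + t * h (2 * i) ≤ y ∧ y < h (2 * i - 1) + (t + 1) * h (2 * i)) :
      ∃ j, i = j + 1 ∧ x < k (2 * (j + 1)) ∧ h (2 * j + 1) ≤ y ∧
        y < h (2 * (j + 1) + 1) := by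
    obtain ⟨hi, ht, hx, h1, h2⟩ := H
    obtain ⟨j, rfl⟩ := Nat.exists_eq_add_of_le' hi
    rw [hsub] at h1 h2
    exact ⟨j, rfl, hx, hHs j ▸ block_le ht h1 h2⟩
  have lower {i t : ℕ} (H : t < a (2 * i + 2) ∧ k (2 * i) + t * k (2 * i + 1) ≤ x ∧
      x < k (2 * i) + (t + 1) * k (2 * i + 1) ∧ y < h (2 * i + 1)) :
      k (2 * i) ≤ x ∧ x < k (2 * (i + 1)) :=
    hKs i ▸ block_le H.1 H.2.1 H.2.2.1
  have disjoint : ¬((∃ i t : ℕ, 1 ≤ i ∧ t < a (2 * i + 1) ∧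
          x < k (2 * i) ∧ h (2 * i - 1) + t * h (2 * i) ≤ y ∧
          y < h (2 * i - 1) + (t + 1) * h (2 * i)) ∧
        (∃ i t : ℕ, t < a (2 * i + 2) ∧
          k (2 * i) + t * k (2 * i + 1) ≤ x ∧
          x < k (2 * i) + (t + 1) * k (2 * i + 1) ∧ y < h (2 * i + 1))) := by
    rintro ⟨⟨_, t, hA⟩, i, s, hB⟩
    obtain ⟨j, -, hx, hy, -⟩ := upper hA
    have := hK.lt_iff_lt.1 ((lower hB).1.trans_lt hx)
    have := hH.lt_iff_lt.1 (hy.trans_lt hB.2.2.2)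
    omega
  refine ⟨xor_iff_or_and_not_and _ _ |>.2 ⟨?_, disjoint⟩, ?_, ?_⟩
  · rcases hK.exists_staircase hH hk0 hh1 hxy with ⟨j, hx, h1, h2⟩ | ⟨i, h1, h2, hy⟩
    · obtain ⟨t, ht, h3, h4⟩ := exists_block_of_lt h1 (h2.trans_eq (hHs j))
      exact .inl ⟨j + 1, t, by omega, ht, hx, hsub j ▸ h3, hsub j ▸ h4⟩
    · obtain ⟨t, ht, h3, h4⟩ := exists_block_of_lt h1 (h2.trans_eq (hKs i))
      exact .inr ⟨i, t, ht, h3, h4, hy⟩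
  · intro i t i' t' hA hA'
    obtain ⟨j, rfl, -, h1, h2⟩ := upper hA
    obtain ⟨j', rfl, -, h3, h4⟩ := upper hA'
    obtain rfl := hH.index_unique h1 h2 h3 h4
    exact ⟨rfl, block_unique hA.2.2.2.1 hA.2.2.2.2 hA'.2.2.2.1 hA'.2.2.2.2⟩
  · intro i t i' t' hB hB'
    obtain rfl := hK.index_unique (lower hB).1 (lower hB).2 (lower hB').1 (lower hB').2
    exact ⟨rfl, block_unique hB.2.1 hB.2.2.1 hB'.2.1 hB'.2.2.1⟩
end

section
/- For every natural number N there exist elements u < v of S such that v − u > N and no element of S lies strictly between u and v; that is, S has arbitrarily large gaps between consecutive elements. -/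
/-- In an unbounded set of natural numbers, every number bounded below by a member lies between
two consecutive members. -/
theorem exists_consecutive_of_unbounded {P : ℕ → Prop} {a b : ℕ} (hb : P b) (hba : b ≤ a)
    (hP : ∃ c, a < c ∧ P c) :
    ∃ u v, P u ∧ P v ∧ u ≤ a ∧ a < v ∧ ∀ w, P w → ¬(u < w ∧ w < v) := by
  classical
  refine ⟨Nat.findGreatest P a, Nat.find hP, Nat.findGreatest_spec hba hb, (Nat.find_spec hP).2,
    Nat.findGreatest_le a, (Nat.find_spec hP).1, fun w hw ⟨huw, hwv⟩ => ?_⟩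
  rcases le_or_gt w a with h | h
  · exact huw.not_ge (Nat.le_findGreatest h hw)
  · exact Nat.find_min hP hwv ⟨h, hw⟩

theorem two_mul_add_eleven_sq_lt_two_pow (n : ℕ) : (2 * n + 11) ^ 2 < 2 ^ (n + 10) := by
  induction n with
  | zero => norm_num
  | succ n ih =>
    rw [show n + 1 + 10 = (n + 10) + 1 by ring, pow_succ 2]
    have : (2 * (n + 1) + 11) ^ 2 ≤ (2 * n + 11) ^ 2 * 2 := by ring_nf; lia
    lia

/-- The products `p ^ i * q ^ j` are too sparse to meet every interval of a given length. -/
theorem exists_interval_without_pow_mul_pow {p q : ℕ} (hp : 1 < p) (hq : 1 < q) (N : ℕ) :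
    ∃ a, 1 ≤ a ∧ ∀ i j : ℕ, a < p ^ i * q ^ j → a + N < p ^ i * q ^ j := by
  by_contra! h
  choose i j hlt hle using fun k : ℕ => h (1 + k * N) (by lia)
  have hinj : Function.Injective fun k => (i k, j k) := by
    have hmono : StrictMono fun k => p ^ i k * q ^ j k :=
      strictMono_nat_of_lt_succ fun k => (hle k).trans_lt (by have := hlt (k + 1); lia)
    intro k l hkl
    simp only [Prod.mk.injEq] at hkl
    exact hmono.injective (by simp only [hkl.1, hkl.2])
  have hbound : ∀ k < 2 ^ (N + 10), i k + j k < 2 * N + 11 := by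
    intro k hk
    have h2 : 2 ^ (i k + j k) ≤ p ^ i k * q ^ j k := by
      rw [pow_add]
      exact Nat.mul_le_mul (Nat.pow_le_pow_left hp _) (Nat.pow_le_pow_left hq _)
    have h3 : (k + 1) * N ≤ 2 ^ (N + 10) * N := Nat.mul_le_mul_right N hk
    have h4 : 2 ^ (N + 10) * (N + 1) ≤ 2 ^ (N + 10) * 2 ^ N :=
      Nat.mul_le_mul_left _ Nat.lt_two_pow_self
    have h5 : 2 ^ (N + 10) * 2 ^ N < 2 ^ (2 * N + 11) := by
      rw [← pow_add]
      exact Nat.pow_lt_pow_right one_lt_two (by lia)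
    refine (Nat.pow_lt_pow_iff_right one_lt_two).mp ?_
    have := hle k
    have := Nat.one_le_two_pow (n := N + 10)
    linarith
  have hcard := Finset.card_le_card_of_injOn (s := Finset.range (2 ^ (N + 10)))
    (t := Finset.range (2 * N + 11) ×ˢ Finset.range (2 * N + 11)) (fun k => (i k, j k))
    (fun k hk => by
      have := hbound k (by simpa using hk)
      simp only [Finset.coe_product, Finset.coe_range, Set.mem_prod, Set.mem_Iio]
      lia)
    hinj.injOn
  simp only [Finset.card_product, Finset.card_range] at hcard
  have := two_mul_add_eleven_sq_lt_two_pow N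
  lia

/- S = {p1^i * p2^j} has arbitrarily large gaps between consecutive elements. -/
theorem stmt_16 (p1 p2 : ℕ) (hp1 : 1 < p1) (hp12 : p1 < p2)
    (hγirr : Irrational (Real.log p1 / Real.log p2)) :
    ∀ N : ℕ, ∃ u v : ℕ,
      (∃ i j : ℕ, u = p1 ^ i * p2 ^ j) ∧ (∃ i j : ℕ, v = p1 ^ i * p2 ^ j) ∧
      u < v ∧ N < v - u ∧
      ∀ w : ℕ, (∃ i j : ℕ, w = p1 ^ i * p2 ^ j) → ¬(u < w ∧ w < v) := by
  intro N
  obtain ⟨a, ha, hgap⟩ := exists_interval_without_pow_mul_pow hp1 (hp1.trans hp12) N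
  obtain ⟨u, v, hu, ⟨i, j, rfl⟩, hua, hav, huv⟩ :=
    exists_consecutive_of_unbounded (P := fun w => ∃ i j : ℕ, w = p1 ^ i * p2 ^ j)
      ⟨0, 0, by simp⟩ ha ⟨p1 ^ a, Nat.lt_pow_self hp1, a, 0, by simp⟩
  have := hgap i j hav
  exact ⟨u, _, hu, ⟨i, j, rfl⟩, hua.trans_lt hav, by lia, huv⟩
end
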